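/- Let W be a group with two Coxeter generating sets S and S' such that in both Coxeter systems every subset of more than 2 generators generates an infinite subgroup. Then |S| = |S'|, the Coxeter diagrams of (W,S) and (W,S') have the same number of edges, and the multisets of edge labels {m(s,t) : s ≠ t, 2 ≤ m(s,t) < ∞} coincide. -/

import Mathlib

set_option linter.all false

namespace Cox2

open CoxeterSystem

section Rep

variable {B : Type*} [Fintype B] [DecidableEq B] (M : CoxeterMatrix B)

/-- The (doubled) coefficients of the Tits form. -/
noncomputable def cc (i j : B) : ℝ := -2 * Real.cos (Real.pi / (M i j : ℝ))

theorem cc_self (i : B) : cc M i i = 2 := by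
  simp [cc, M.diagonal i]

theorem cc_symm (i j : B) : cc M i j = cc M j i := by
  simp [cc, M.symmetric i j]

/-- The functional `v ↦ 2 B(α_i, v)`. -/
noncomputable def pf (i : B) : (B → ℝ) →ₗ[ℝ] ℝ := ∑ j, cc M i j • LinearMap.proj j

theorem pf_apply (i : B) (v : B → ℝ) : pf M i v = ∑ j, cc M i j * v j := by
  simp [pf]

/-- Simple roots. -/
def al (i : B) : B → ℝ := Pi.single i 1

theorem al_self (i : B) : al i i = 1 := by simp [al]

theorem al_ne {i j : B} (h : j ≠ i) : al i j = 0 := by simp [al, h]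

theorem pf_al (i j : B) : pf M i (al j) = cc M i j := by
  rw [pf_apply, Finset.sum_eq_single j]
  · simp [al_self]
  · intro b _ hb; simp [al_ne hb]
  · simp

/-- Simple reflections of the geometric representation. -/
noncomputable def sg (i : B) : Module.End ℝ (B → ℝ) :=
  LinearMap.id - (pf M i).smulRight (al i)

theorem sg_apply (i : B) (v : B → ℝ) : sg M i v = v - pf M i v • al i := by
  simp [sg]

theorem sg_sg (i : B) (v : B → ℝ) : sg M i (sg M i v) = v := by
  simp only [sg_apply, map_sub, map_smul, pf_al, cc_self, smul_eq_mul]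
  module

theorem sg_pow_al (i j : B) (k : ℕ) (θ : ℝ) (hθ : cc M i j = -2 * Real.cos θ) :
    Real.sin θ • ((sg M i * sg M j) ^ k) (al i) =
        Real.sin ((2 * k + 1) * θ) • al i + Real.sin (2 * k * θ) • al j ∧
    Real.sin θ • ((sg M i * sg M j) ^ k) (al j) =
        - Real.sin (2 * k * θ) • al i - Real.sin ((2 * k - 1) * θ) • al j := by
  have hθ' : cc M j i = -2 * Real.cos θ := by rw [cc_symm, hθ]
  have hc : Real.sin θ ^ 2 = 1 - Real.cos θ ^ 2 := Real.sin_sq θ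
  induction k with
  | zero => constructor <;> simp
  | succ k ih =>
    have e1 : Real.sin ((2 * k + 1) * θ) = Real.sin (2 * k * θ) * Real.cos θ
        + Real.cos (2 * k * θ) * Real.sin θ := by rw [← Real.sin_add]; congr 1; ring
    have e2 : Real.sin ((2 * k - 1) * θ) = Real.sin (2 * k * θ) * Real.cos θ
        - Real.cos (2 * k * θ) * Real.sin θ := by rw [← Real.sin_sub]; congr 1; ring
    have e3 : Real.sin (2 * (↑(k + 1) : ℝ) * θ) = Real.sin (2 * k * θ) * (2 * Real.cos θ ^ 2 - 1)
        + Real.cos (2 * k * θ) * (2 * Real.sin θ * Real.cos θ) := by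
      rw [← Real.cos_two_mul, ← Real.sin_two_mul, ← Real.sin_add]; congr 1; push_cast; ring
    have e4 : Real.sin ((2 * (↑(k + 1) : ℝ) - 1) * θ) = Real.sin (2 * k * θ) * Real.cos θ
        + Real.cos (2 * k * θ) * Real.sin θ := by rw [← Real.sin_add]; congr 1; push_cast; ring
    have e5 : Real.sin ((2 * (↑(k + 1) : ℝ) + 1) * θ) =
        Real.sin (2 * k * θ) * (4 * Real.cos θ ^ 3 - 3 * Real.cos θ)
        + Real.cos (2 * k * θ) * (3 * Real.sin θ - 4 * Real.sin θ ^ 3) := by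
      rw [← Real.cos_three_mul, ← Real.sin_three_mul, ← Real.sin_add]; congr 1; push_cast; ring
    have h3 : Real.sin θ ^ 3 = Real.sin θ * (1 - Real.cos θ ^ 2) := by rw [← hc]; ring
    rw [pow_succ']
    simp only [Module.End.mul_apply]
    constructor
    · rw [← map_smul, ← map_smul, ih.1, e1, e3, e5, h3]
      simp only [sg_apply, map_add, map_sub, map_smul, pf_al, cc_self, smul_eq_mul, hθ, hθ']
      match_scalars <;> ring
    · rw [← map_smul, ← map_smul, ih.2, e2, e3, e4]
      simp only [sg_apply, map_add, map_sub, map_smul, pf_al, cc_self, smul_eq_mul, hθ, hθ']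
      match_scalars <;> ring

theorem sg_pow_fix (i j : B) (k : ℕ) (v : B → ℝ) (h1 : pf M i v = 0) (h2 : pf M j v = 0) :
    ((sg M i * sg M j) ^ k) v = v := by
  induction k with
  | zero => simp
  | succ k ih => rw [pow_succ]; simp [Module.End.mul_apply, sg_apply, h1, h2, ih]

theorem sin_pos_of_ne {i j : B} (h : i ≠ j) (h0 : M i j ≠ 0) :
    0 < Real.sin (Real.pi / (M i j : ℝ)) := by
  have h1 : M i j ≠ 1 := M.off_diagonal i j h
  have h2 : 2 ≤ M i j := by omega
  have h3 : (2 : ℝ) ≤ M i j := by exact_mod_cast h2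
  apply Real.sin_pos_of_pos_of_lt_pi
  · have := Real.pi_pos; positivity
  · exact div_lt_self Real.pi_pos (by linarith)

theorem sg_liftable : M.IsLiftable (sg M) := by
  intro i j
  by_cases hij : i = j
  · subst hij
    rw [M.diagonal i, pow_one]
    exact LinearMap.ext fun v => sg_sg M i v
  by_cases h0 : M i j = 0
  · rw [h0, pow_zero]
  set θ := Real.pi / (M i j : ℝ) with hθ
  have hs : 0 < Real.sin θ := sin_pos_of_ne M hij h0
  have hs2 : Real.sin θ ^ 2 = 1 - Real.cos θ ^ 2 := Real.sin_sq θ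
  have hc : cc M i j = -2 * Real.cos θ := rfl
  have hc' : cc M j i = -2 * Real.cos θ := by rw [cc_symm, hc]
  obtain ⟨ha, hb⟩ := sg_pow_al M i j (M i j) θ hc
  have hm : (M i j : ℝ) * θ = Real.pi := by
    rw [hθ]; field_simp
  have t1 : Real.sin ((2 * (M i j : ℝ) + 1) * θ) = Real.sin θ := by
    rw [show (2 * (M i j : ℝ) + 1) * θ = θ + 2 * Real.pi by linear_combination 2 * hm]
    exact Real.sin_add_two_pi θ
  have t2 : Real.sin (2 * (M i j : ℝ) * θ) = 0 := by
    rw [show 2 * (M i j : ℝ) * θ = 2 * Real.pi by linear_combination 2 * hm]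
    exact Real.sin_two_pi
  have t3 : Real.sin ((2 * (M i j : ℝ) - 1) * θ) = - Real.sin θ := by
    rw [show (2 * (M i j : ℝ) - 1) * θ = 2 * Real.pi - θ by linear_combination 2 * hm]
    exact Real.sin_two_pi_sub θ
  rw [t1, t2, zero_smul, add_zero] at ha
  rw [t2, t3, neg_zero, zero_smul, zero_sub, neg_smul, neg_neg] at hb
  have ha' := smul_right_injective _ hs.ne' ha
  have hb' := smul_right_injective _ hs.ne' hb
  refine LinearMap.ext fun v => ?_
  set x := (pf M i v + Real.cos θ * pf M j v) / (2 * Real.sin θ ^ 2) with hx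
  set y := (pf M j v + Real.cos θ * pf M i v) / (2 * Real.sin θ ^ 2) with hy
  have hv : v = (v - x • al i - y • al j) + x • al i + y • al j := by module
  have f1 : pf M i (v - x • al i - y • al j) = 0 := by
    simp only [map_sub, map_smul, pf_al, cc_self, smul_eq_mul, hc]
    rw [hx, hy]; field_simp; rw [hs2]; ring
  have f2 : pf M j (v - x • al i - y • al j) = 0 := by
    simp only [map_sub, map_smul, pf_al, cc_self, smul_eq_mul, hc']
    rw [hx, hy]; field_simp; rw [hs2]; ring
  conv_lhs => rw [hv]
  rw [map_add, map_add, map_smul, map_smul, ha', hb', sg_pow_fix M i j _ _ f1 f2]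
  exact hv.symm

end Rep

section Main

variable {B : Type*} [Fintype B] [DecidableEq B] {M : CoxeterMatrix B}
  {W : Type*} [Group W] (cs : CoxeterSystem M W)

/-- The geometric representation. -/
noncomputable def rho : W →* Module.End ℝ (B → ℝ) := cs.lift ⟨sg M, sg_liftable M⟩

theorem rho_simple (i : B) : rho cs (cs.simple i) = sg M i := cs.lift_apply_simple _ _

theorem rho_mul (u v : W) (x : B → ℝ) : rho cs (u * v) x = rho cs u (rho cs v x) := by
  rw [map_mul]; rfl

theorem rho_one (x : B → ℝ) : rho cs 1 x = x := by
  rw [map_one]; rfl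

theorem rho_inv_self (u : W) (x : B → ℝ) : rho cs u⁻¹ (rho cs u x) = x := by
  rw [← rho_mul, inv_mul_cancel, rho_one]

theorem rho_self_inv (u : W) (x : B → ℝ) : rho cs u (rho cs u⁻¹ x) = x := by
  rw [← rho_mul, mul_inv_cancel, rho_one]

theorem rho_inj (u : W) : Function.Injective (rho cs u) := fun x y h => by
  rw [← rho_inv_self cs u x, h, rho_inv_self]

/-- The sequence `sin(kθ)/sin θ`. -/
noncomputable def us (c : ℝ) : ℕ → ℝ
  | 0 => 0
  | 1 => 1
  | (k+2) => 2 * c * us c (k+1) - us c k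

theorem us_sin (θ : ℝ) (k : ℕ) : Real.sin θ * us (Real.cos θ) k = Real.sin (k * θ) := by
  induction k using Nat.twoStepInduction with
  | zero => simp [us]
  | one => simp [us]
  | more k h1 h2 =>
    rw [us, mul_sub, h1, show Real.sin θ * (2 * Real.cos θ * us (Real.cos θ) (k+1)) =
      2 * Real.cos θ * (Real.sin θ * us (Real.cos θ) (k+1)) by ring, h2]
    have e1 : ((k + 2 : ℕ) : ℝ) * θ = ((k + 1 : ℕ) : ℝ) * θ + θ := by push_cast; ring
    have e2 : (k : ℝ) * θ = ((k + 1 : ℕ) : ℝ) * θ - θ := by push_cast; ring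
    rw [e1, e2, Real.sin_add, Real.sin_sub]; ring

theorem us_one (k : ℕ) : us 1 k = k := by
  induction k using Nat.twoStepInduction with
  | zero => simp [us]
  | one => simp [us]
  | more k h1 h2 => rw [us, h1, h2]; push_cast; ring

theorem us_nonneg {i j : B} (hij : i ≠ j) (k : ℕ) (hk : M i j = 0 ∨ k ≤ M i j) :
    0 ≤ us (Real.cos (Real.pi / (M i j : ℝ))) k := by
  by_cases h0 : M i j = 0
  · rw [h0]; simp [us_one]
  have hk : k ≤ M i j := by tauto
  have hs := sin_pos_of_ne M hij h0
  have := us_sin (Real.pi / (M i j : ℝ)) k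
  refine nonneg_of_mul_nonneg_right (a := Real.sin (Real.pi / (M i j : ℝ))) ?_ hs
  rw [this]
  have hM : (0 : ℝ) < M i j := by exact_mod_cast Nat.pos_of_ne_zero h0
  apply Real.sin_nonneg_of_nonneg_of_le_pi
  · have := Real.pi_pos; positivity
  · rw [mul_div_assoc', div_le_iff₀ hM, mul_comm]
    exact mul_le_mul_of_nonneg_left (by exact_mod_cast hk) Real.pi_pos.le

theorem rho_alt (i j : B) (k : ℕ) :
    rho cs (cs.wordProd (alternatingWord i j k)) (al i) =
      if Even k then us (Real.cos (Real.pi / (M i j : ℝ))) (k+1) • al i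
          + us (Real.cos (Real.pi / (M i j : ℝ))) k • al j
        else us (Real.cos (Real.pi / (M i j : ℝ))) k • al i
          + us (Real.cos (Real.pi / (M i j : ℝ))) (k+1) • al j := by
  have hc : cc M i j = -2 * Real.cos (Real.pi / (M i j : ℝ)) := rfl
  have hc' : cc M j i = -2 * Real.cos (Real.pi / (M i j : ℝ)) := by rw [cc_symm, hc]
  induction k with
  | zero => simp [alternatingWord, us, rho_one]
  | succ k ih =>
    rw [alternatingWord_succ', wordProd_cons, rho_mul, ih]
    by_cases hk : Even k
    · have hk' : ¬ Even (k + 1) := by simpa [Nat.even_add_one] using hk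
      simp only [hk, hk', if_true, if_false, rho_simple]
      simp only [sg_apply, map_add, map_sub, map_smul, pf_al, cc_self, smul_eq_mul, hc, hc', us]
      match_scalars <;> ring
    · have hk' : Even (k + 1) := by simpa [Nat.even_add_one] using hk
      simp only [hk, hk', if_true, if_false, rho_simple]
      simp only [sg_apply, map_add, map_sub, map_smul, pf_al, cc_self, smul_eq_mul, hc, hc', us]
      match_scalars <;> ring

end Main

end Cox2

set_option linter.all false

namespace Cox2

open CoxeterSystem

section Roots

variable {B : Type*} [Fintype B] [DecidableEq B] {M : CoxeterMatrix B}
  {W : Type*} [Group W] (cs : CoxeterSystem M W)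

theorem al_nonneg (i : B) : 0 ≤ al i := by
  intro j
  by_cases h : j = i
  · subst h; simp [al_self]
  · simp [al_ne h]

theorem al_ne_zero (i : B) : al i ≠ 0 := fun h => by
  have := congrFun h i
  simp [al_self] at this

theorem pos_of_not_descent : ∀ (n : ℕ) (w : W), cs.length w = n → ∀ s : B,
    ¬ cs.IsRightDescent w s → 0 ≤ rho cs w (al s) := by
  intro n
  induction n using Nat.strong_induction_on with
  | _ n IH =>
  intro w hn s hs
  by_cases hw : w = 1
  · subst hw; rw [rho_one]; exact al_nonneg s
  obtain ⟨t, ht⟩ := cs.exists_rightDescent_of_ne_one hw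
  have hst : s ≠ t := by rintro rfl; exact hs ht
  rw [not_isRightDescent_iff] at hs
  rw [isRightDescent_iff] at ht
  classical
  set P : ℕ → Prop := fun k => ∃ v, w = v * cs.wordProd (alternatingWord s t k) ∧
    cs.length v + k = cs.length w with hP
  have P1 : P 1 := ⟨w * cs.simple t, by simp [alternatingWord], ht⟩
  have hPle : ∀ k, P k → k ≤ cs.length w := by rintro k ⟨v, _, h⟩; omega
  have hPk : P (Nat.findGreatest P (cs.length w)) :=
    Nat.findGreatest_spec (m := 1) (hPle 1 P1) P1
  have hk1 : 1 ≤ Nat.findGreatest P (cs.length w) := Nat.le_findGreatest (hPle 1 P1) P1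
  have hPn : ¬ P (Nat.findGreatest P (cs.length w) + 1) := fun h => by
    have := Nat.le_findGreatest (hPle _ h) h
    omega
  generalize Nat.findGreatest P (cs.length w) = k at hPk hk1 hPn
  obtain ⟨v, hv, hvl⟩ := hPk
  obtain ⟨k', rfl⟩ : ∃ k', k = k' + 1 := ⟨k - 1, by omega⟩
  have hn1 : ¬ cs.IsRightDescent v (if Even (k' + 1) then t else s) := by
    intro h
    rw [isRightDescent_iff] at h
    refine hPn ⟨v * cs.simple (if Even (k' + 1) then t else s), ?_, by omega⟩
    rw [alternatingWord_succ', wordProd_cons, ← mul_assoc, simple_mul_simple_cancel_right]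
    exact hv
  have hn2 : ¬ cs.IsRightDescent v (if Even k' then t else s) := by
    intro h
    rw [isRightDescent_iff] at h
    rw [alternatingWord_succ', wordProd_cons, ← mul_assoc] at hv
    have h1 := cs.length_mul_le (v * cs.simple (if Even k' then t else s))
      (cs.wordProd (alternatingWord s t k'))
    have h2 := cs.length_wordProd_le (alternatingWord s t k')
    rw [length_alternatingWord] at h2
    rw [← hv] at h1
    omega
  have hvs : ¬ cs.IsRightDescent v s ∧ ¬ cs.IsRightDescent v t := by
    by_cases he : Even k'
    · have he' : ¬ Even (k' + 1) := by simpa [Nat.even_add_one] using he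
      simp only [he, he', if_true, if_false] at hn1 hn2
      exact ⟨hn1, hn2⟩
    · have he' : Even (k' + 1) := by simpa [Nat.even_add_one] using he
      simp only [he, he', if_true, if_false] at hn1 hn2
      exact ⟨hn2, hn1⟩
  have hvs1 := IH (cs.length v) (by omega) v rfl s hvs.1
  have hvs2 := IH (cs.length v) (by omega) v rfl t hvs.2
  have hm : M s t = 0 ∨ k' + 1 + 1 ≤ M s t := by
    by_contra hcon
    push Not at hcon
    have hnr := cs.not_isReduced_alternatingWord t s (m := k' + 1 + 1)
      (by rw [M.symmetric]; exact hcon.1) (by rw [M.symmetric]; exact hcon.2)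
    have h2 := cs.length_wordProd_le (alternatingWord t s (k' + 1 + 1))
    rw [length_alternatingWord] at h2
    have h3 : cs.length (cs.wordProd (alternatingWord t s (k' + 1 + 1))) ≠ k' + 1 + 1 := by
      intro h; apply hnr; unfold CoxeterSystem.IsReduced; rw [h, length_alternatingWord]
    have h4 : w * cs.simple s = v * cs.wordProd (alternatingWord t s (k' + 1 + 1)) := by
      rw [alternatingWord_succ t s (k' + 1), wordProd_concat, ← mul_assoc, ← hv]
    have h5 := cs.length_mul_le v (cs.wordProd (alternatingWord t s (k' + 1 + 1)))
    rw [← h4] at h5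
    omega
  have u1 := us_nonneg (M := M) hst (k' + 1) (by omega)
  have u2 := us_nonneg (M := M) hst (k' + 1 + 1) hm
  rw [hv, rho_mul, rho_alt]
  split_ifs
  · rw [map_add, map_smul, map_smul]
    exact add_nonneg (smul_nonneg u2 hvs1) (smul_nonneg u1 hvs2)
  · rw [map_add, map_smul, map_smul]
    exact add_nonneg (smul_nonneg u1 hvs1) (smul_nonneg u2 hvs2)

theorem sg_al (i : B) : sg M i (al i) = - al i := by
  rw [sg_apply, pf_al, cc_self]; module

theorem rho_mul_simple_al (w : W) (s : B) :
    rho cs (w * cs.simple s) (al s) = - rho cs w (al s) := by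
  rw [rho_mul, rho_simple, sg_al, map_neg]

theorem neg_of_descent {w : W} {s : B} (h : cs.IsRightDescent w s) : rho cs w (al s) ≤ 0 := by
  have := pos_of_not_descent cs _ (w * cs.simple s) rfl s
    (cs.isRightDescent_iff_not_isRightDescent_mul.mp h)
  rw [rho_mul_simple_al] at this
  exact neg_nonneg.mp this

/-- The set of roots. -/
def Rt : Set (B → ℝ) := {v | ∃ w s, v = rho cs w (al s)}

theorem Rt_ne_zero {v : B → ℝ} (h : v ∈ Rt cs) : v ≠ 0 := by
  obtain ⟨w, s, rfl⟩ := h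
  intro h0
  exact al_ne_zero s (rho_inj cs w (by rw [h0, map_zero]))

theorem Rt_al (i : B) : al i ∈ Rt cs := ⟨1, i, (rho_one cs _).symm⟩

theorem Rt_rho {v : B → ℝ} (h : v ∈ Rt cs) (u : W) : rho cs u v ∈ Rt cs := by
  obtain ⟨w, s, rfl⟩ := h
  exact ⟨u * w, s, (rho_mul cs _ _ _).symm⟩

theorem Rt_sg {v : B → ℝ} (h : v ∈ Rt cs) (i : B) : sg M i v ∈ Rt cs := by
  rw [← rho_simple cs]; exact Rt_rho cs h _

theorem Rt_neg {v : B → ℝ} (h : v ∈ Rt cs) : -v ∈ Rt cs := by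
  obtain ⟨w, s, rfl⟩ := h
  exact ⟨w * cs.simple s, s, (rho_mul_simple_al cs _ _).symm⟩

theorem Rt_sign {v : B → ℝ} (h : v ∈ Rt cs) : 0 ≤ v ∨ v ≤ 0 := by
  obtain ⟨w, s, rfl⟩ := h
  by_cases hd : cs.IsRightDescent w s
  · exact Or.inr (neg_of_descent cs hd)
  · exact Or.inl (pos_of_not_descent cs _ w rfl s hd)

theorem Rt_not_both {v : B → ℝ} (h : v ∈ Rt cs) (h1 : 0 ≤ v) (h2 : v ≤ 0) : False :=
  Rt_ne_zero cs h (le_antisymm h2 h1)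

theorem Rt_nonneg_of_pos {v : B → ℝ} (h : v ∈ Rt cs) {i : B} (hi : 0 < v i) : 0 ≤ v := by
  rcases Rt_sign cs h with h | h
  · exact h
  · exact absurd (h i) (not_le.mpr hi)

theorem Rt_nonpos_of_neg {v : B → ℝ} (h : v ∈ Rt cs) {i : B} (hi : v i < 0) : v ≤ 0 := by
  rcases Rt_sign cs h with h | h
  · exact absurd (h i) (not_le.mpr hi)
  · exact h

theorem descent_of_neg {w : W} {s : B} (h : rho cs w (al s) ≤ 0) : cs.IsRightDescent w s := by
  by_contra hd
  exact Rt_not_both cs ⟨w, s, rfl⟩ (pos_of_not_descent cs _ w rfl s hd) h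

theorem eq_one_of_pos {w : W} (h : ∀ s, 0 ≤ rho cs w (al s)) : w = 1 := by
  by_contra hw
  obtain ⟨t, ht⟩ := cs.exists_rightDescent_of_ne_one hw
  exact Rt_not_both cs ⟨w, t, rfl⟩ (h t) (neg_of_descent cs ht)

/-- The (doubled) Tits form. -/
noncomputable def bf (M : CoxeterMatrix B) : (B → ℝ) →ₗ[ℝ] (B → ℝ) →ₗ[ℝ] ℝ :=
  ∑ i, (LinearMap.proj i : (B → ℝ) →ₗ[ℝ] ℝ).smulRight (pf M i)

theorem bf_apply (v w : B → ℝ) : bf M v w = ∑ i, v i * pf M i w := by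
  simp [bf, LinearMap.sum_apply]

theorem bf_al_left (i : B) (w : B → ℝ) : bf M (al i) w = pf M i w := by
  rw [bf_apply, Finset.sum_eq_single i]
  · simp [al_self]
  · intro b _ hb; simp [al_ne hb]
  · simp

theorem bf_al_right (i : B) (w : B → ℝ) : bf M w (al i) = pf M i w := by
  rw [bf_apply, pf_apply]
  refine Finset.sum_congr rfl fun j _ => ?_
  rw [pf_al, cc_symm, mul_comm]

theorem bf_sg (i : B) (v : B → ℝ) : bf M (sg M i v) (sg M i v) = bf M v v := by
  simp only [sg_apply, map_sub, map_smul, LinearMap.sub_apply, LinearMap.smul_apply, bf_al_left,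
    bf_al_right, pf_al, cc_self, smul_eq_mul]
  ring

theorem bf_rho (w : W) : ∀ (v : B → ℝ), bf M (rho cs w v) (rho cs w v) = bf M v v := by
  induction w using cs.simple_induction_left with
  | one => intro v; simp
  | mul_simple_left w i ih =>
    intro v
    rw [rho_mul, rho_simple, bf_sg, ih]

theorem bf_Rt {v : B → ℝ} (h : v ∈ Rt cs) : bf M v v = 2 := by
  obtain ⟨w, s, rfl⟩ := h
  rw [bf_rho, bf_al_left, pf_al, cc_self]

theorem sg_apply_ne {i j : B} (h : j ≠ i) (v : B → ℝ) : sg M i v j = v j := by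
  rw [sg_apply]; simp [al_ne h]

theorem eq_al_of_inv {v : B → ℝ} {i : B} (h : v ∈ Rt cs) (h0 : 0 ≤ v) (h1 : sg M i v ≤ 0) :
    v = al i := by
  have hv : v = v i • al i := by
    funext j
    by_cases hj : j = i
    · subst hj; simp [al_self]
    · have := h1 j
      rw [sg_apply_ne hj] at this
      have h2 : v j = 0 := le_antisymm this (h0 j)
      simp [al_ne hj, h2]
  have hb := bf_Rt cs h
  rw [hv] at hb
  simp only [map_smul, LinearMap.smul_apply, bf_al_left, pf_al, cc_self, smul_eq_mul] at hb
  have : v i = 1 := by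
    have h3 : 0 ≤ v i := h0 i
    nlinarith
  rw [hv, this, one_smul]

theorem sg_nonneg {v : B → ℝ} {i : B} (h : v ∈ Rt cs) (h0 : 0 ≤ v) (h1 : v ≠ al i) :
    0 ≤ sg M i v := by
  rcases Rt_sign cs (Rt_sg cs h i) with h2 | h2
  · exact h2
  · exact absurd (eq_al_of_inv cs h h0 h2) h1

theorem inv_finite (w : W) : {v | v ∈ Rt cs ∧ 0 ≤ v ∧ rho cs w v ≤ 0}.Finite := by
  induction w using cs.simple_induction_right with
  | one =>
    convert Set.finite_empty
    ext v
    simp only [rho_one, Set.mem_setOf_eq, Set.mem_empty_iff_false, iff_false]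
    rintro ⟨a, b, c⟩
    exact Rt_not_both cs a b c
  | mul_simple_right w i ih =>
    refine ((Set.finite_singleton (al i)).union (ih.image (sg M i))).subset ?_
    rintro v ⟨h, h0, h1⟩
    by_cases hv : v = al i
    · left; exact hv
    · right
      rw [rho_mul, rho_simple] at h1
      exact ⟨sg M i v, ⟨Rt_sg cs h i, sg_nonneg cs h h0 hv, h1⟩, sg_sg M i v⟩

/-- Standard parabolic subgroups. -/
abbrev WJ (J : Set B) : Subgroup W := Subgroup.closure (cs.simple '' J)

theorem simple_mem_WJ {J : Set B} {j : B} (h : j ∈ J) : cs.simple j ∈ WJ cs J :=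
  Subgroup.subset_closure ⟨j, h, rfl⟩

theorem par_fix {J : Set B} {u : W} (hu : u ∈ WJ cs J) {i : B} (hi : i ∉ J) :
    ∀ v : B → ℝ, rho cs u v i = v i := by
  induction hu using Subgroup.closure_induction with
  | mem x hx =>
    obtain ⟨j, hj, rfl⟩ := hx
    intro v
    rw [rho_simple, sg_apply_ne]
    rintro rfl; exact hi hj
  | one => intro v; rw [rho_one]
  | mul x y _ _ hx hy => intro v; rw [rho_mul, hx, hy]
  | inv x _ hx => intro v; have := hx (rho cs x⁻¹ v); rw [rho_self_inv] at this; exact this.symm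

theorem par_eq_one {J : Set B} {u : W} (hu : u ∈ WJ cs J)
    (h : ∀ j ∈ J, 0 ≤ rho cs u (al j)) : u = 1 := by
  apply eq_one_of_pos cs
  intro i
  by_cases hi : i ∈ J
  · exact h i hi
  · apply Rt_nonneg_of_pos cs ⟨u, i, rfl⟩ (i := i)
    rw [par_fix cs hu hi, al_self]; norm_num

/-- Roots of a parabolic subgroup. -/
def RJ (J : Set B) : Set (B → ℝ) := {v | ∃ u ∈ WJ cs J, ∃ j ∈ J, v = rho cs u (al j)}

theorem RJ_subset {J : Set B} {v : B → ℝ} (h : v ∈ RJ cs J) : v ∈ Rt cs := by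
  obtain ⟨u, _, j, _, rfl⟩ := h
  exact ⟨u, j, rfl⟩

theorem RJ_supp {J : Set B} {v : B → ℝ} (h : v ∈ RJ cs J) {i : B} (hi : i ∉ J) : v i = 0 := by
  obtain ⟨u, hu, j, hj, rfl⟩ := h
  rw [par_fix cs hu hi, al_ne]
  rintro rfl; exact hi hj

theorem WJ_finite {J : Set B} (h : {v | v ∈ RJ cs J ∧ 0 ≤ v}.Finite) :
    (WJ cs J : Set W).Finite := by
  have hR : (RJ cs J).Finite := by
    refine (h.union (h.image (fun v => -v))).subset ?_
    intro v hv
    rcases Rt_sign cs (RJ_subset cs hv) with h0 | h0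
    · left; exact ⟨hv, h0⟩
    · right
      refine ⟨-v, ⟨?_, neg_nonneg.mpr h0⟩, neg_neg v⟩
      obtain ⟨u, hu, j, hj, rfl⟩ := hv
      exact ⟨u * cs.simple j, mul_mem hu (simple_mem_WJ cs hj), j, hj,
        (rho_mul_simple_al cs u j).symm⟩
  classical
  refine Set.Finite.of_injOn (f := fun (u : W) (j : B) => if j ∈ J then rho cs u (al j) else 0)
    (t := Set.pi Set.univ (fun _ : B => insert (0 : B → ℝ) (RJ cs J))) ?_ ?_ ?_
  · intro u hu j _
    by_cases hj : j ∈ J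
    · simp only [hj, if_true]; right; exact ⟨u, hu, j, hj, rfl⟩
    · simp only [hj, if_false]; left; rfl
  · intro u hu v hv huv
    have : u⁻¹ * v = 1 := by
      apply par_eq_one cs (mul_mem (inv_mem hu) hv)
      intro j hj
      have := congrFun huv j
      simp only [hj, if_true] at this
      rw [rho_mul, ← this, rho_inv_self]
      exact al_nonneg j
    exact inv_mul_eq_one.mp this
  · exact Set.Finite.pi fun _ => hR.insert 0

theorem exists_longest {T : Set B} (h : (WJ cs T : Set W).Finite) :
    ∃ x ∈ WJ cs T, ∀ t ∈ T, rho cs x (al t) ≤ 0 := by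
  obtain ⟨x, hx, hmax⟩ := Set.exists_max_image _ cs.length h ⟨1, one_mem _⟩
  refine ⟨x, hx, fun t ht => neg_of_descent cs ?_⟩
  by_contra hd
  rw [not_isRightDescent_iff] at hd
  have := hmax (x * cs.simple t) (mul_mem hx (simple_mem_WJ cs ht))
  omega

theorem pow_ne_one {i j : B} (hij : i ≠ j) (h0 : M i j ≠ 0) {k : ℕ} (hk0 : 0 < k)
    (hk : k < M i j) : (cs.simple i * cs.simple j) ^ k ≠ 1 := by
  intro h
  have h1 := rho_alt cs i j (2 * k)
  rw [prod_alternatingWord_eq_mul_pow] at h1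
  simp only [even_two, Even.mul_right, if_true, one_mul] at h1
  rw [Nat.mul_div_cancel_left _ (by norm_num), h, rho_one] at h1
  have e1 := congrFun h1 i
  have e2 := congrFun h1 j
  simp only [Pi.add_apply, Pi.smul_apply, al_self, al_ne hij, al_ne hij.symm, smul_eq_mul,
    mul_one, mul_zero, add_zero, zero_add] at e1 e2
  set θ := Real.pi / (M i j : ℝ) with hθ
  have hs : 0 < Real.sin θ := sin_pos_of_ne M hij h0
  have f1 := us_sin θ (2 * k + 1)
  have f2 := us_sin θ (2 * k)
  rw [← e1, mul_one] at f1
  rw [← e2, mul_zero] at f2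
  have hMp : (0 : ℝ) < M i j := by exact_mod_cast Nat.pos_of_ne_zero h0
  have hm : (M i j : ℝ) * θ = Real.pi := by
    rw [hθ]; field_simp
  have hθ0 : 0 < θ := by rw [hθ]; have := Real.pi_pos; positivity
  have hc : Real.cos ((2 * k : ℕ) * θ) = 1 := by
    push_cast at f1 f2 ⊢
    rw [add_mul, one_mul, Real.sin_add, ← f2, zero_mul, zero_add] at f1
    exact (mul_right_cancel₀ hs.ne' (by rw [one_mul]; exact f1)).symm
  rw [Real.cos_eq_one_iff] at hc
  obtain ⟨n, hn⟩ := hc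
  have hkm : (k : ℝ) < M i j := by exact_mod_cast hk
  have hk0' : (0 : ℝ) < k := by exact_mod_cast hk0
  push_cast at hn
  have hn1 : (n : ℝ) * Real.pi = k * θ := by linarith
  have hn2 : (0 : ℝ) < n := by
    have : 0 < (n : ℝ) * Real.pi := by rw [hn1]; positivity
    exact pos_of_mul_pos_left this Real.pi_pos.le
  have hn3 : (n : ℝ) < 1 := by
    have : (n : ℝ) * Real.pi < 1 * Real.pi := by
      rw [hn1, one_mul, ← hm]; exact mul_lt_mul_of_pos_right hkm hθ0
    exact lt_of_mul_lt_mul_right this Real.pi_pos.le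
  have h4 : 0 < n := by exact_mod_cast hn2
  have h5 : n < 1 := by exact_mod_cast hn3
  omega

end Roots

end Cox2

set_option linter.all false

namespace Cox2

open CoxeterSystem

section Fin

variable {B : Type*} [Fintype B] [DecidableEq B] {M : CoxeterMatrix B}
  {W : Type*} [Group W] (cs : CoxeterSystem M W)

theorem eq_sum_al (v : B → ℝ) : v = ∑ i, v i • al i := by
  funext j
  rw [Finset.sum_apply, Finset.sum_eq_single j]
  · simp [al_self]
  · intro b _ hb; simp [al_ne hb.symm]
  · simp

theorem lin_nonneg (y : (B → ℝ) →ₗ[ℝ] ℝ) (hy : ∀ i, 0 ≤ y (al i)) {v : B → ℝ} (hv : 0 ≤ v) :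
    0 ≤ y v := by
  rw [eq_sum_al v, map_sum]
  refine Finset.sum_nonneg fun i _ => ?_
  rw [map_smul]
  exact mul_nonneg (hv i) (hy i)

theorem stab_mem (y : (B → ℝ) →ₗ[ℝ] ℝ) (hy : ∀ i, 0 ≤ y (al i)) :
    ∀ (n : ℕ) (g : W), cs.length g = n → (∀ v, y (rho cs g v) = y v) →
      g ∈ WJ cs {i | y (al i) = 0} := by
  intro n
  induction n using Nat.strong_induction_on with
  | _ n IH =>
  intro g hn hg
  by_cases h1 : g = 1
  · rw [h1]; exact one_mem _
  obtain ⟨s, hs⟩ := cs.exists_rightDescent_of_ne_one h1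
  have h2 := neg_of_descent cs hs
  have h3 := lin_nonneg y hy (neg_nonneg.mpr h2)
  rw [map_neg, hg] at h3
  have h4 : y (al s) = 0 := by have := hy s; linarith
  have h5 := IH (cs.length (g * cs.simple s)) (by rw [← hn]; exact hs) (g * cs.simple s) rfl (by
    intro v
    rw [rho_mul, hg, rho_simple, sg_apply, map_sub, map_smul, h4, smul_zero, sub_zero])
  have h6 := mul_mem h5 (simple_mem_WJ cs (J := {i | y (al i) = 0}) (j := s) h4)
  rwa [simple_mul_simple_cancel_right] at h6

/-- Sum of coordinates. -/
noncomputable def x0 : (B → ℝ) →ₗ[ℝ] ℝ := ∑ i : B, LinearMap.proj i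

theorem x0_pos {v : B → ℝ} (h : v ∈ Rt cs) (h0 : 0 ≤ v) : 0 < x0 v := by
  have e : x0 v = ∑ i, v i := by simp [x0]
  rw [e]
  refine (Finset.sum_nonneg fun i _ => h0 i).lt_of_ne ?_
  intro hs
  apply Rt_ne_zero cs h
  funext i
  exact (Finset.sum_eq_zero_iff_of_nonneg (fun i _ => h0 i)).mp hs.symm i (Finset.mem_univ i)

theorem finite_conj (H : Subgroup W) (hH : (H : Set W).Finite) :
    ∃ (w : W) (T : Set B), (WJ cs T : Set W).Finite ∧ ∀ h ∈ H, w⁻¹ * h * w ∈ WJ cs T := by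
  classical
  set x : (B → ℝ) →ₗ[ℝ] ℝ := ∑ h ∈ hH.toFinset, x0 ∘ₗ (rho cs h) with hx
  have hxa : ∀ v, x v = ∑ h ∈ hH.toFinset, x0 (rho cs h v) := by
    intro v; simp [hx, LinearMap.sum_apply]
  have hxH : ∀ g ∈ H, ∀ v, x (rho cs g v) = x v := by
    intro g hg v
    rw [hxa, hxa]
    refine Finset.sum_nbij' (fun h => h * g) (fun h => h * g⁻¹) ?_ ?_ ?_ ?_ ?_
    · intro a ha
      simp only [Set.Finite.mem_toFinset, SetLike.mem_coe] at ha ⊢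
      exact mul_mem ha hg
    · intro a ha
      simp only [Set.Finite.mem_toFinset, SetLike.mem_coe] at ha ⊢
      exact mul_mem ha (inv_mem hg)
    · intro a _; simp
    · intro a _; simp
    · intro a _; rw [rho_mul]
  have hN : {v | v ∈ Rt cs ∧ 0 ≤ v ∧ x v ≤ 0}.Finite := by
    refine (hH.biUnion (fun h _ => inv_finite cs h)).subset ?_
    rintro v ⟨h, h0, h1⟩
    by_contra hcon
    have hpos : ∀ g ∈ H, 0 ≤ rho cs g v := by
      intro g hg
      rcases Rt_sign cs (Rt_rho cs h g) with h2 | h2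
      · exact h2
      · exact (hcon (Set.mem_biUnion (show g ∈ (H : Set W) from hg) (show v ∈ {v | v ∈ Rt cs ∧ 0 ≤ v ∧ rho cs g v ≤ 0} from ⟨h, h0, h2⟩))).elim
    have : 0 < x v := by
      rw [hxa]
      apply Finset.sum_pos
      · intro g hg
        simp only [Set.Finite.mem_toFinset, SetLike.mem_coe] at hg
        exact x0_pos cs (Rt_rho cs h g) (hpos g hg)
      · exact ⟨1, by simp [one_mem]⟩
    linarith
  have hZ : ∀ w, {v | v ∈ Rt cs ∧ 0 ≤ v ∧ x (rho cs w v) ≤ 0}.Finite := by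
    intro w
    refine ((inv_finite cs w).union (hN.image (rho cs w⁻¹))).subset ?_
    rintro v ⟨h, h0, h1⟩
    rcases Rt_sign cs (Rt_rho cs h w) with h2 | h2
    · right; exact ⟨rho cs w v, ⟨Rt_rho cs h w, h2, h1⟩, rho_inv_self cs w v⟩
    · left; exact ⟨h, h0, h2⟩
  set D : W → Set (B → ℝ) := fun w => {v | v ∈ Rt cs ∧ 0 ≤ v ∧ x (rho cs w v) < 0} with hD
  have hDf : ∀ w, (D w).Finite := fun w =>
    (hZ w).subset (fun v ⟨a, b, c⟩ => ⟨a, b, c.le⟩)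
  obtain ⟨w, -, hw⟩ := (measure fun w => (D w).ncard).wf.has_min Set.univ ⟨1, trivial⟩
  have hdom : ∀ s, 0 ≤ x (rho cs w (al s)) := by
    intro s
    by_contra hneg
    push Not at hneg
    refine hw (w * cs.simple s) trivial ?_
    show (D (w * cs.simple s)).ncard < (D w).ncard
    have hs : al s ∈ D w := ⟨Rt_al cs s, al_nonneg s, hneg⟩
    have h1 : ((sg M s) '' (D (w * cs.simple s))) ⊆ D w \ {al s} := by
      rintro _ ⟨v, ⟨h, h0, h2⟩, rfl⟩
      rw [rho_mul, rho_simple] at h2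
      have hv : v ≠ al s := by
        rintro rfl
        rw [sg_al, map_neg, map_neg] at h2
        linarith
      refine ⟨⟨Rt_sg cs h s, sg_nonneg cs h h0 hv, h2⟩, ?_⟩
      intro h3
      have h3 : sg M s v = al s := h3
      have h4 : v = - al s := by rw [← sg_sg M s v, h3, sg_al]
      have := h0 s
      rw [h4] at this
      simp [al_self] at this
      linarith
    have hinj : Function.Injective (sg M s) := fun a b hab => by
      rw [← sg_sg M s a, hab, sg_sg]
    rw [← Set.ncard_image_of_injective _ hinj]
    exact (Set.ncard_le_ncard h1 ((hDf w).diff)).trans_lt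
      (Set.ncard_diff_singleton_lt_of_mem hs (hDf w))
  set y : (B → ℝ) →ₗ[ℝ] ℝ := x ∘ₗ rho cs w with hy
  have hya : ∀ v, y v = x (rho cs w v) := fun v => rfl
  refine ⟨w, {i | y (al i) = 0}, ?_, ?_⟩
  · apply WJ_finite
    refine (hZ w).subset ?_
    rintro v ⟨h, h0⟩
    refine ⟨RJ_subset cs h, h0, ?_⟩
    rw [← hya, eq_sum_al v, map_sum]
    refine (Finset.sum_eq_zero fun i _ => ?_).le
    rw [map_smul]
    by_cases hi : y (al i) = 0
    · rw [hi, smul_zero]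
    · rw [RJ_supp cs h (i := i) hi, zero_smul]
  · intro h hh
    apply stab_mem cs y hdom _ _ rfl
    intro v
    rw [hya, hya, rho_mul, rho_mul, rho_self_inv, hxH h hh]

theorem supp_card {T' J : Set B} (w : W) (h : ∀ t ∈ J, ∀ i ∉ T', rho cs w (al t) i = 0) :
    J.ncard ≤ T'.ncard := by
  classical
  let E : (J → ℝ) →ₗ[ℝ] (B → ℝ) :=
    { toFun := fun c i => if h : i ∈ J then c ⟨i, h⟩ else 0
      map_add' := by
        intro a b; funext i; by_cases hi : i ∈ J <;> simp [hi]
      map_smul' := by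
        intro a b; funext i; by_cases hi : i ∈ J <;> simp [hi] }
  have hE : ∀ c i, E c i = if h : i ∈ J then c ⟨i, h⟩ else 0 := fun c i => rfl
  let L : (J → ℝ) →ₗ[ℝ] (T' → ℝ) := (LinearMap.funLeft ℝ ℝ (fun t : T' => (t : B))) ∘ₗ
    (rho cs w) ∘ₗ E
  have hL : ∀ c t, L c t = rho cs w (E c) t := fun c t => rfl
  have hinj : Function.Injective L := by
    rw [← LinearMap.ker_eq_bot, LinearMap.ker_eq_bot']
    intro c hc
    have h1 : rho cs w (E c) = 0 := by
      funext i
      by_cases hi : i ∈ T'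
      · have := congrFun hc ⟨i, hi⟩
        rwa [hL] at this
      · rw [eq_sum_al (E c), map_sum, Finset.sum_apply]
        refine Finset.sum_eq_zero fun j _ => ?_
        rw [map_smul, Pi.smul_apply, hE]
        by_cases hj : j ∈ J
        · rw [h j hj i hi, smul_zero]
        · simp [hj]
    have h2 : E c = 0 := rho_inj cs w (by rw [h1, map_zero])
    funext j
    have := congrFun h2 j
    rw [hE] at this
    simpa using this
  have := LinearMap.finrank_le_finrank_of_injective hinj
  rw [Module.finrank_fintype_fun_eq_card, Module.finrank_fintype_fun_eq_card] at this
  rwa [← Set.fintypeCard_eq_ncard, ← Set.fintypeCard_eq_ncard]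

theorem edge_conj (hdim : ∀ T : Set B, 2 < T.ncard → (WJ cs T : Set W).Infinite)
    {T T' : Set B} (hT : T.ncard = 2) (hT' : T'.ncard = 2) (hfin : (WJ cs T : Set W).Finite)
    (w₀ : W) (hw₀ : ∀ t ∈ T, w₀ * cs.simple t * w₀⁻¹ ∈ WJ cs T') : T = T' := by
  set P : W → Prop := fun w => ∀ t ∈ T, ∀ i ∉ T', rho cs w (al t) i = 0 with hP
  have hP0 : P w₀ := by
    intro t ht i hi
    have h1 := par_fix cs (hw₀ t ht) hi (rho cs w₀ (al t))
    rw [← rho_mul, inv_mul_cancel_right, rho_mul_simple_al, Pi.neg_apply] at h1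
    linarith
  obtain ⟨w, hw, hmin⟩ := (measure fun w => cs.length w).wf.has_min {w | P w} ⟨w₀, hP0⟩
  have hw : P w := hw
  have hw1 : w = 1 := by
    by_contra hne
    obtain ⟨s, hs⟩ := cs.exists_rightDescent_of_ne_one hne
    have hsT : s ∉ T := by
      intro hsT
      refine hmin (w * cs.simple s) ?_ hs
      intro t ht i hi
      rw [rho_mul, rho_simple, sg_apply, map_sub, map_smul, Pi.sub_apply, Pi.smul_apply,
        hw t ht i hi, hw s hsT i hi, smul_zero, sub_zero]
    have hJ : (insert s T).ncard = 3 := by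
      rw [Set.ncard_insert_of_notMem hsT (Set.toFinite T), hT]
    have hneg := neg_of_descent cs hs
    obtain ⟨i, hi, hi'⟩ : ∃ i ∉ T', rho cs w (al s) i < 0 := by
      by_contra hcon
      push Not at hcon
      have := supp_card cs (J := insert s T) (T' := T') w (by
        intro t ht i hi
        rcases ht with rfl | ht
        · exact le_antisymm (hneg i) (hcon i hi)
        · exact hw t ht i hi)
      omega
    obtain ⟨x, hx, hxn⟩ := exists_longest cs hfin
    refine hdim (insert s T) (by omega) (WJ_finite cs ?_)
    refine ((inv_finite cs w).union (inv_finite cs x)).subset ?_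
    rintro v ⟨h, h0⟩
    have hR := RJ_subset cs h
    rcases (h0 s).eq_or_lt with hs0 | hs0
    · right
      refine ⟨hR, h0, ?_⟩
      rw [eq_sum_al v, map_sum]
      refine Finset.sum_nonpos fun j _ => ?_
      rw [map_smul]
      by_cases hj : j ∈ T
      · exact smul_nonpos_of_nonneg_of_nonpos (h0 j) (hxn j hj)
      · have : v j = 0 := by
          by_cases hjs : j = s
          · rw [hjs]; exact hs0.symm
          · exact RJ_supp cs h (by simp [hj, hjs])
        rw [this, zero_smul]
    · left
      refine ⟨hR, h0, ?_⟩
      apply Rt_nonpos_of_neg cs (Rt_rho cs hR w) (i := i)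
      have : rho cs w v i = v s * rho cs w (al s) i := by
        conv_lhs => rw [eq_sum_al v]
        rw [map_sum, Finset.sum_apply, Finset.sum_eq_single s]
        · rw [map_smul]; rfl
        · intro j _ hjs
          rw [map_smul, Pi.smul_apply]
          by_cases hj : j ∈ T
          · rw [hw j hj i hi, smul_zero]
          · rw [RJ_supp cs h (by simp [hj, hjs]), zero_smul]
        · simp
      rw [this]
      exact mul_neg_of_pos_of_neg hs0 hi'
  subst hw1
  apply Set.eq_of_subset_of_ncard_le ?_ (by omega) (Set.toFinite T')
  intro t ht
  by_contra hcon
  have := hw t ht t hcon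
  rw [rho_one, al_self] at this
  norm_num at this

theorem orderOf_mul {i j : B} (hij : i ≠ j) (h0 : M i j ≠ 0) :
    orderOf (cs.simple i * cs.simple j) = M i j := by
  rw [orderOf_eq_iff (Nat.pos_of_ne_zero h0)]
  exact ⟨cs.simple_mul_simple_pow i j, fun k hk hk0 => pow_ne_one cs hij h0 hk0 hk⟩

theorem WJ_pair_card {i j : B} (hij : i ≠ j) (h0 : M i j ≠ 0) :
    (WJ cs {i, j} : Set W).Finite ∧ (WJ cs {i, j} : Set W).ncard = 2 * M i j := by
  set r := cs.simple i * cs.simple j with hr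
  set Z := Subgroup.zpowers r with hZ
  have hrZ : r ∈ Z := Subgroup.mem_zpowers r
  have hi : cs.simple i ∈ WJ cs {i, j} := simple_mem_WJ cs (by simp)
  have hj : cs.simple j ∈ WJ cs {i, j} := simple_mem_WJ cs (by simp)
  have hZle : Z ≤ WJ cs {i, j} := by
    rw [hZ, Subgroup.zpowers_le]; exact mul_mem hi hj
  have hri : cs.simple j * cs.simple i = r⁻¹ := by simp [hr]
  have hmem : ∀ x ∈ WJ cs {i, j}, x ∈ Z ∨ x * cs.simple i ∈ Z := by
    intro x hx
    have key : ∀ x y, y ∈ cs.simple '' {i, j} → (x ∈ Z ∨ x * cs.simple i ∈ Z) →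
        (x * y ∈ Z ∨ x * y * cs.simple i ∈ Z) := by
      rintro x y ⟨k, hk, rfl⟩ h
      rcases hk with rfl | hk
      · rw [simple_mul_simple_cancel_right]; exact h.symm
      · have hk : k = j := hk
        subst hk
        rcases h with h | h
        · right; rw [mul_assoc, hri]; exact mul_mem h (inv_mem hrZ)
        · left
          have := mul_mem h hrZ
          rwa [hr, ← mul_assoc, simple_mul_simple_cancel_right] at this
    induction hx using Subgroup.closure_induction_right with
    | one => left; exact one_mem _
    | mul_right x hx y hy ih => exact key x y hy ih
    | mul_inv_cancel x hx y hy ih =>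
      obtain ⟨k, hk, rfl⟩ := hy
      rw [inv_simple]
      exact key x _ ⟨k, hk, rfl⟩ ih
  have hpZ : ∀ x ∈ Z, cs.lengthParity x = 1 := by
    intro x hx
    rw [hZ] at hx
    have : Z ≤ cs.lengthParity.ker := by
      rw [hZ, Subgroup.zpowers_le, MonoidHom.mem_ker, hr, map_mul, lengthParity_simple,
        lengthParity_simple]
      decide
    exact this hx
  have hset : (WJ cs {i, j} : Set W) = (Z : Set W) ∪ (fun x => x * cs.simple i) '' (Z : Set W) := by
    ext x
    constructor
    · intro hx
      rcases hmem x hx with h | h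
      · left; exact h
      · right; exact ⟨_, h, by simp⟩
    · rintro (h | ⟨y, h, rfl⟩)
      · exact hZle h
      · exact mul_mem (hZle h) hi
  have hcard : (Z : Set W).ncard = M i j := by
    rw [← orderOf_mul cs hij h0, ← Nat.card_zpowers]; rfl
  have hfin : (Z : Set W).Finite := Set.finite_of_ncard_ne_zero (by rw [hcard]; exact h0)
  have hdisj : Disjoint (Z : Set W) ((fun x => x * cs.simple i) '' (Z : Set W)) := by
    rw [Set.disjoint_left]
    rintro x hx ⟨y, hy, rfl⟩
    have h1 := hpZ _ hx
    rw [map_mul, hpZ y hy, lengthParity_simple] at h1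
    exact absurd h1 (by decide)
  rw [hset]
  refine ⟨hfin.union (hfin.image _), ?_⟩
  rw [Set.ncard_union_eq hdisj hfin (hfin.image _),
    Set.ncard_image_of_injective _ (mul_left_injective _), hcard]
  ring

end Fin

end Cox2

set_option linter.all false

namespace Cox2

open CoxeterSystem

section Edge

variable {B : Type*} [Fintype B] [DecidableEq B] {M : CoxeterMatrix B}
  {B' : Type*} [Fintype B'] [DecidableEq B'] {M' : CoxeterMatrix B'}
  {W : Type*} [Group W] (cs : CoxeterSystem M W) (cs' : CoxeterSystem M' W)

theorem pow_ne_one_inf {i j : B} (hij : i ≠ j) (h0 : M i j = 0) {k : ℕ} (hk0 : 0 < k) :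
    (cs.simple i * cs.simple j) ^ k ≠ 1 := by
  intro h
  have h1 := rho_alt cs i j (2 * k)
  rw [prod_alternatingWord_eq_mul_pow] at h1
  simp only [even_two, Even.mul_right, if_true, one_mul] at h1
  rw [Nat.mul_div_cancel_left _ (by norm_num), h, rho_one] at h1
  have e2 := congrFun h1 j
  simp only [Pi.add_apply, Pi.smul_apply, al_self, al_ne hij, al_ne hij.symm, smul_eq_mul,
    mul_one, mul_zero, add_zero, zero_add] at e2
  rw [h0] at e2
  simp only [Nat.cast_zero, div_zero, Real.cos_zero, us_one] at e2
  push_cast at e2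
  have : (0 : ℝ) < k := by exact_mod_cast hk0
  linarith

theorem label_ne_zero {i j : B} (hij : i ≠ j) (h : (WJ cs {i, j} : Set W).Finite) :
    M i j ≠ 0 := by
  intro h0
  have hmem : cs.simple i * cs.simple j ∈ WJ cs {i, j} :=
    mul_mem (simple_mem_WJ cs (by simp)) (simple_mem_WJ cs (by simp))
  have hfin : Finite (WJ cs {i, j}) := h
  have h1 := isOfFinOrder_of_finite (⟨_, hmem⟩ : WJ cs {i, j})
  rw [isOfFinOrder_iff_pow_eq_one] at h1
  obtain ⟨n, hn, h2⟩ := h1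
  have h3 := congrArg Subtype.val h2
  exact pow_ne_one_inf cs hij h0 hn h3

theorem WJ_small {T : Set B} (hT : T.ncard ≤ 1) : (WJ cs T : Set W).ncard ≤ 2 := by
  have hsub : ∃ x : W, (WJ cs T : Set W) ⊆ {1, x} := by
    rcases Set.ncard_le_one_iff_eq (Set.toFinite T) |>.1 hT with h | ⟨a, h⟩
    · refine ⟨1, ?_⟩
      subst h
      intro x hx
      simp only [WJ, Set.image_empty, Subgroup.closure_empty] at hx
      left; simpa using hx
    · refine ⟨cs.simple a, ?_⟩
      subst h
      intro x hx
      simp only [WJ, Set.image_singleton, SetLike.mem_coe] at hx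
      induction hx using Subgroup.closure_induction with
      | mem x hx => right; exact hx
      | one => left; rfl
      | mul x y hx hy h1 h2 =>
        rcases h1 with rfl | h1 <;> rcases h2 with rfl | h2 <;>
          simp_all
      | inv x hx h => rcases h with rfl | h <;> simp_all
  obtain ⟨x, hx⟩ := hsub
  exact (Set.ncard_le_ncard hx).trans ((Set.ncard_insert_le 1 {x}).trans (by rw [Set.ncard_singleton]))

theorem conj_le {H K : Subgroup W} (w : W) (hK : (K : Set W).Finite)
    (h : ∀ x ∈ H, w⁻¹ * x * w ∈ K) : (H : Set W).ncard ≤ (K : Set W).ncard := by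
  refine Set.ncard_le_ncard_of_injOn (fun x => w⁻¹ * x * w) h ?_ hK
  intro a _ b _ hab
  simpa using hab

theorem to_pair (hdim : ∀ T : Set B, 2 < T.ncard → (WJ cs T : Set W).Infinite)
    (H : Subgroup W) (hH : (H : Set W).Finite) (hc : 2 < (H : Set W).ncard) :
    ∃ (w : W) (i j : B), i ≠ j ∧ M i j ≠ 0 ∧ ∀ h ∈ H, w⁻¹ * h * w ∈ WJ cs {i, j} := by
  obtain ⟨w, T, hT, h⟩ := finite_conj cs H hH
  have h1 := conj_le w hT h
  have h2 : ¬ T.ncard ≤ 1 := fun h2 => by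
    have := WJ_small cs h2
    omega
  have h3 : ¬ 2 < T.ncard := fun h3 => hdim T h3 hT
  obtain ⟨i, j, hij, rfl⟩ := Set.ncard_eq_two.1 (show T.ncard = 2 by omega)
  exact ⟨w, i, j, hij, label_ne_zero cs hij hT, h⟩

theorem label_ge {i j : B} (hij : i ≠ j) (h0 : M i j ≠ 0) : 2 ≤ M i j := by
  have := M.off_diagonal i j hij
  omega

theorem edge_map (hdim : ∀ T : Set B, 2 < T.ncard → (WJ cs T : Set W).Infinite)
    (hdim' : ∀ T : Set B', 2 < T.ncard → (WJ cs' T : Set W).Infinite)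
    {i j : B} (hij : i ≠ j) (h0 : M i j ≠ 0) :
    ∃ a b : B', a ≠ b ∧ M' a b ≠ 0 ∧ M i j = M' a b ∧
      (∃ w : W, ∀ h ∈ WJ cs {i, j}, w⁻¹ * h * w ∈ WJ cs' {a, b}) ∧
      (∃ w : W, ∀ h ∈ WJ cs' {a, b}, w⁻¹ * h * w ∈ WJ cs {i, j}) := by
  obtain ⟨hf, hc⟩ := WJ_pair_card cs hij h0
  have hge := label_ge hij h0
  obtain ⟨w, a, b, hab, hab0, h⟩ := to_pair cs' hdim' (WJ cs {i, j}) hf (by omega)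
  obtain ⟨hf', hc'⟩ := WJ_pair_card cs' hab hab0
  have hge' := label_ge hab hab0
  obtain ⟨w', k, l, hkl, hkl0, h'⟩ := to_pair cs hdim (WJ cs' {a, b}) hf' (by omega)
  have heq : ({i, j} : Set B) = {k, l} := by
    refine edge_conj cs hdim (Set.ncard_pair hij) (Set.ncard_pair hkl) hf (w'⁻¹ * w⁻¹) ?_
    intro t ht
    have := h' _ (h _ (simple_mem_WJ cs ht))
    convert this using 1
    group
  rw [← heq] at h'
  refine ⟨a, b, hab, hab0, ?_, ⟨w, h⟩, ⟨w', h'⟩⟩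
  have e1 := conj_le w hf' h
  have e2 := conj_le w' hf h'
  omega

end Edge

section EdgeOrd

variable {B : Type*} [Fintype B] [LinearOrder B] {M : CoxeterMatrix B}
  {B' : Type*} [Fintype B'] [LinearOrder B'] {M' : CoxeterMatrix B'}
  {W : Type*} [Group W] (cs : CoxeterSystem M W) (cs' : CoxeterSystem M' W)

/-- Unordered edges, as increasing pairs. -/
abbrev Ed (M : CoxeterMatrix B) := {p : B × B // p.1 < p.2 ∧ M p.1 p.2 ≠ 0}

/-- Ordered edges. -/
abbrev Eo (M : CoxeterMatrix B) := {p : B × B // p.1 ≠ p.2 ∧ M p.1 p.2 ≠ 0}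

theorem edge_map_lt (hdim : ∀ T : Set B, 2 < T.ncard → (WJ cs T : Set W).Infinite)
    (hdim' : ∀ T : Set B', 2 < T.ncard → (WJ cs' T : Set W).Infinite) :
    ∃ f : Ed M → Ed M', Function.Injective f ∧ ∀ p, M p.1.1 p.1.2 = M' (f p).1.1 (f p).1.2 := by
  have key : ∀ p : Ed M, ∃ q : Ed M', M p.1.1 p.1.2 = M' q.1.1 q.1.2 ∧
      (∃ w : W, ∀ h ∈ WJ cs {p.1.1, p.1.2}, w⁻¹ * h * w ∈ WJ cs' {q.1.1, q.1.2}) ∧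
      (∃ w : W, ∀ h ∈ WJ cs' {q.1.1, q.1.2}, w⁻¹ * h * w ∈ WJ cs {p.1.1, p.1.2}) := by
    rintro ⟨⟨i, j⟩, hij, h0⟩
    obtain ⟨a, b, hab, hab0, h1, h2, h3⟩ := edge_map cs cs' hdim hdim' hij.ne h0
    rcases lt_or_gt_of_ne hab with h | h
    · exact ⟨⟨⟨a, b⟩, h, hab0⟩, h1, h2, h3⟩
    · refine ⟨⟨⟨b, a⟩, h, by rwa [M'.symmetric]⟩, ?_, ?_, ?_⟩
      · dsimp only at h1 ⊢
        rw [h1, M'.symmetric]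
      · dsimp only; rw [Set.pair_comm b a]; exact h2
      · dsimp only; rw [Set.pair_comm b a]; exact h3
  choose f hf1 hf2 hf3 using key
  refine ⟨f, ?_, hf1⟩
  intro p q hpq
  obtain ⟨w, hw⟩ := hf2 p
  obtain ⟨w', hw'⟩ := hf3 q
  rw [hpq] at hw
  have heq : ({p.1.1, p.1.2} : Set B) = {q.1.1, q.1.2} := by
    refine edge_conj cs hdim (Set.ncard_pair p.2.1.ne) (Set.ncard_pair q.2.1.ne)
      (WJ_pair_card cs p.2.1.ne p.2.2).1 (w'⁻¹ * w⁻¹) ?_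
    intro t ht
    have := hw' _ (hw _ (simple_mem_WJ cs ht))
    convert this using 1
    group
  rw [Set.pair_eq_pair_iff] at heq
  have hp := p.2.1
  have hq := q.2.1
  rcases heq with ⟨h1, h2⟩ | ⟨h1, h2⟩
  · exact Subtype.ext (Prod.ext h1 h2)
  · rw [h1, h2] at hp
    exact absurd hp hq.not_gt

theorem edge_map_ne (f : Ed M → Ed M') (hf : Function.Injective f)
    (hl : ∀ p, M p.1.1 p.1.2 = M' (f p).1.1 (f p).1.2) :
    ∃ g : Eo M → Eo M', Function.Injective g ∧
      ∀ p, M p.1.1 p.1.2 = M' (g p).1.1 (g p).1.2 := by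
  have hgt : ∀ p : Eo M, ¬ p.1.1 < p.1.2 → p.1.2 < p.1.1 := fun p h =>
    lt_of_le_of_ne (not_lt.1 h) p.2.1.symm
  refine ⟨fun p => if h : p.1.1 < p.1.2 then
      ⟨(f ⟨p.1, h, p.2.2⟩).1, (f ⟨p.1, h, p.2.2⟩).2.1.ne, (f ⟨p.1, h, p.2.2⟩).2.2⟩
    else
      ⟨(f ⟨p.1.swap, hgt p h, by simpa [M.symmetric] using p.2.2⟩).1.swap,
        (f ⟨p.1.swap, hgt p h, by simpa [M.symmetric] using p.2.2⟩).2.1.ne', by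
        have := (f ⟨p.1.swap, hgt p h, by simpa [M.symmetric] using p.2.2⟩).2.2
        rw [M'.symmetric] at this
        exact this⟩, ?_, ?_⟩
  · intro p q hpq
    by_cases hp : p.1.1 < p.1.2 <;> by_cases hq : q.1.1 < q.1.2
    · simp only [hp, hq, dif_pos, Subtype.mk.injEq] at hpq
      have := hf (Subtype.ext hpq)
      simp only [Subtype.mk.injEq] at this
      exact Subtype.ext this
    · exfalso
      simp only [hp, hq, dif_pos, dif_neg, not_false_eq_true, Subtype.mk.injEq] at hpq
      have h1 := (f ⟨p.1, hp, p.2.2⟩).2.1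
      rw [hpq] at h1
      exact h1.not_gt (f _).2.1
    · exfalso
      simp only [hp, hq, dif_pos, dif_neg, not_false_eq_true, Subtype.mk.injEq] at hpq
      have h1 := (f ⟨q.1, hq, q.2.2⟩).2.1
      rw [← hpq] at h1
      exact h1.not_gt (f _).2.1
    · simp only [hp, hq, dif_neg, not_false_eq_true, Subtype.mk.injEq] at hpq
      have := hf (Subtype.ext (Prod.swap_injective hpq))
      simp only [Subtype.mk.injEq] at this
      exact Subtype.ext (Prod.swap_injective this)
  · intro p
    by_cases hp : p.1.1 < p.1.2
    · simp only [hp, dif_pos]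
      exact hl ⟨p.1, hp, p.2.2⟩
    · simp only [hp, dif_neg, not_false_eq_true]
      have := hl ⟨p.1.swap, hgt p hp, by simpa [M.symmetric] using p.2.2⟩
      simp only [Prod.fst_swap, Prod.snd_swap] at this ⊢
      exact (M.symmetric _ _).trans (this.trans (M'.symmetric _ _))

theorem inj_card {α β : Type*} [Finite α] [Finite β] (f : α → β) (g : β → α)
    (hf : Function.Injective f) (hg : Function.Injective g) : Function.Bijective f := by
  have h1 := Nat.card_le_card_of_injective f hf
  have h2 := Nat.card_le_card_of_injective g hg
  exact (Nat.bijective_iff_injective_and_card f).2 ⟨hf, le_antisymm h1 h2⟩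

theorem edges_main (hdim : ∀ T : Set B, 2 < T.ncard → (WJ cs T : Set W).Infinite)
    (hdim' : ∀ T : Set B', 2 < T.ncard → (WJ cs' T : Set W).Infinite) :
    Nat.card (Ed M) = Nat.card (Ed M') ∧ ∃ e : Eo M ≃ Eo M',
      ∀ p, M p.1.1 p.1.2 = M' (e p).1.1 (e p).1.2 := by
  obtain ⟨f, hf, hl⟩ := edge_map_lt cs cs' hdim hdim'
  obtain ⟨f', hf', hl'⟩ := edge_map_lt cs' cs hdim' hdim
  obtain ⟨g, hg, gl⟩ := edge_map_ne f hf hl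
  obtain ⟨g', hg', gl'⟩ := edge_map_ne f' hf' hl'
  refine ⟨Nat.card_eq_of_bijective f (inj_card f f' hf hf'),
    Equiv.ofBijective g (inj_card g g' hg hg'), gl⟩

end EdgeOrd

end Cox2

set_option linter.all false

namespace Cox2

open CoxeterSystem

section Cocycle

variable {B : Type*} [Fintype B] [LinearOrder B] {M : CoxeterMatrix B}
  {W : Type*} [Group W] (cs : CoxeterSystem M W)

/-- Longer endpoint of the edge `{w, s w}`. -/
noncomputable def tp (s : B) (w : W) : W :=
  if cs.length w < cs.length (cs.simple s * w) then cs.simple s * w else w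

theorem tp_mul (s : B) (w : W) : tp cs s (cs.simple s * w) = tp cs s w := by
  have h := cs.length_simple_mul_ne w s
  unfold tp
  rw [simple_mul_simple_cancel_left]
  split_ifs <;> first | rfl | omega

open Classical in
/-- Value on the edge with top `x` and label `s`. -/
noncomputable def Fn (b : B → B → ℤˣ) (x : W) (s : B) : ℤˣ :=
  if h : ∃ t, s < t ∧ M s t ≠ 0 ∧ cs.IsLeftDescent x s ∧ cs.IsLeftDescent x t then
    b s h.choose * ∏ k ∈ Finset.range (M s h.choose),
      ((if h1 : cs.length (tp cs s (cs.simple h.choose *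
          ((cs.simple s * cs.simple h.choose) ^ k * x))) < cs.length x then
          Fn b (tp cs s (cs.simple h.choose * ((cs.simple s * cs.simple h.choose) ^ k * x))) s
        else 1) *
      (if h1 : cs.length (tp cs h.choose ((cs.simple s * cs.simple h.choose) ^ k * x))
          < cs.length x then
          Fn b (tp cs h.choose ((cs.simple s * cs.simple h.choose) ^ k * x)) h.choose
        else 1))
  else 1
termination_by cs.length x
decreasing_by all_goals exact h1

/-- The edge cochain. -/
noncomputable def ph (b : B → B → ℤˣ) (s : B) (w : W) : ℤˣ := Fn cs b (tp cs s w) s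

theorem ph_mul (b : B → B → ℤˣ) (s : B) (w : W) :
    ph cs b s (cs.simple s * w) = ph cs b s w := by
  unfold ph; rw [tp_mul]

theorem neg_of_left {x : W} {s : B} (h : cs.IsLeftDescent x s) : rho cs x⁻¹ (al s) ≤ 0 := by
  apply neg_of_descent
  rwa [isRightDescent_inv_iff]

theorem nonpos_of_supp {x : W} {J : Set B} (hJ : ∀ j ∈ J, rho cs x (al j) ≤ 0) {v : B → ℝ}
    (h0 : 0 ≤ v) (h : ∀ i ∉ J, v i = 0) : rho cs x v ≤ 0 := by
  rw [eq_sum_al v, map_sum]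
  refine Finset.sum_nonpos fun j _ => ?_
  rw [map_smul]
  by_cases hj : j ∈ J
  · exact smul_nonpos_of_nonneg_of_nonpos (h0 j) (hJ j hj)
  · rw [h j hj, zero_smul]

theorem no_three (hdim : ∀ T : Set B, 2 < T.ncard → (WJ cs T : Set W).Infinite) {x : W}
    {s t u : B} (h1 : cs.IsLeftDescent x s) (h2 : cs.IsLeftDescent x t)
    (h3 : cs.IsLeftDescent x u) (hst : s ≠ t) (hsu : s ≠ u) (htu : t ≠ u) : False := by
  refine hdim {s, t, u} ?_ (WJ_finite cs ?_)
  · rw [Set.ncard_eq_three.2 ⟨s, t, u, hst, hsu, htu, rfl⟩]; norm_num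
  · refine (inv_finite cs x⁻¹).subset ?_
    rintro v ⟨hv, h0⟩
    refine ⟨RJ_subset cs hv, h0, nonpos_of_supp cs (J := {s, t, u}) ?_ h0
      (fun i hi => RJ_supp cs hv hi)⟩
    rintro j (rfl | rfl | rfl)
    · exact neg_of_left cs h1
    · exact neg_of_left cs h2
    · exact neg_of_left cs h3

theorem exists_top {J : Set B} (hJ : (WJ cs J : Set W).Finite) (w : W) :
    ∃ v ∈ WJ cs J, (∀ j ∈ J, cs.IsLeftDescent (v * w) j) ∧
      ∀ u ∈ WJ cs J, u ≠ 1 → cs.length (u * (v * w)) < cs.length (v * w) := by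
  obtain ⟨v, hv, hmax⟩ := hJ.exists_maximalFor (fun v => cs.length (v * w)) _ ⟨1, one_mem _⟩
  have hmax : ∀ u ∈ WJ cs J, cs.length (u * w) ≤ cs.length (v * w) := by
    intro u hu
    rcases le_total (cs.length (u * w)) (cs.length (v * w)) with h | h
    · exact h
    · exact hmax hu h
  have hv : v ∈ WJ cs J := hv
  have desc : ∀ y ∈ WJ cs J, cs.length (y * w) = cs.length (v * w) → ∀ j ∈ J,
      cs.IsLeftDescent (y * w) j := by
    intro y hy he j hj
    have h1 := hmax (cs.simple j * y) (mul_mem (simple_mem_WJ cs hj) hy)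
    have h2 := cs.length_simple_mul_ne (y * w) j
    rw [mul_assoc] at h1
    unfold IsLeftDescent
    omega
  refine ⟨v, hv, desc v hv rfl, ?_⟩
  intro u hu hu1
  have h1 := hmax (u * v) (mul_mem hu hv)
  rw [mul_assoc] at h1
  refine lt_of_le_of_ne h1 fun he => hu1 ?_
  have hd1 := desc v hv rfl
  have hd2 := desc (u * v) (mul_mem hu hv) (by rw [mul_assoc]; exact he)
  rw [← inv_eq_one]
  refine par_eq_one cs (inv_mem hu) ?_
  intro j hj
  have hR : rho cs u⁻¹ (al j) ∈ RJ cs J := ⟨u⁻¹, inv_mem hu, j, hj, rfl⟩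
  rcases Rt_sign cs (RJ_subset cs hR) with h | h
  · exact h
  exfalso
  have e1 := nonpos_of_supp cs (x := (v * w)⁻¹) (J := J) (fun j hj => neg_of_left cs (hd1 j hj))
    (v := - rho cs u⁻¹ (al j)) (by simpa using h)
    (fun i hi => by rw [Pi.neg_apply, RJ_supp cs hR hi, neg_zero])
  have e2 := neg_of_left cs (hd2 j hj)
  rw [map_neg, ← rho_mul, ← mul_inv_rev, ← mul_assoc] at e1
  exact Rt_not_both cs (Rt_rho cs (Rt_al cs j) _) (by simpa using e1) e2

theorem prod_shift {r : W} {m : ℕ} (hr : r ^ m = 1) (h : W → ℤˣ) :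
    ∏ k ∈ Finset.range m, h (r ^ (k + 1)) = ∏ k ∈ Finset.range m, h (r ^ k) := by
  have h1 := Finset.prod_range_succ (fun k => h (r ^ k)) m
  rw [Finset.prod_range_succ'] at h1
  rw [hr, pow_zero] at h1
  exact mul_right_cancel h1

theorem prod_inv' {r : W} {m : ℕ} (hr : r ^ m = 1) (h : W → ℤˣ) :
    ∏ k ∈ Finset.range m, h (r⁻¹ ^ k) = ∏ k ∈ Finset.range m, h (r ^ k) := by
  rw [← prod_shift hr, ← Finset.prod_range_reflect]
  refine Finset.prod_congr rfl fun k hk => ?_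
  rw [Finset.mem_range] at hk
  congr 1
  rw [inv_pow, inv_eq_iff_mul_eq_one, ← pow_add, ← hr]
  congr 1
  omega

/-- Polygon product. -/
noncomputable def GG (φ : B → W → ℤˣ) (s t : B) (w : W) : ℤˣ :=
  ∏ k ∈ Finset.range (M s t), (φ s (cs.simple t * ((cs.simple s * cs.simple t) ^ k * w)) *
    φ t ((cs.simple s * cs.simple t) ^ k * w))

theorem GG_r (φ : B → W → ℤˣ) (s t : B) (w : W) :
    GG cs φ s t (cs.simple s * cs.simple t * w) = GG cs φ s t w := by
  unfold GG
  rw [← prod_shift (cs.simple_mul_simple_pow s t)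
    (fun z => φ s (cs.simple t * (z * w)) * φ t (z * w))]
  refine Finset.prod_congr rfl fun k _ => ?_
  rw [pow_succ]
  simp only [mul_assoc]

theorem t_r_t (s t : B) (k : ℕ) (w : W) :
    (cs.simple s * cs.simple t) ^ k * (cs.simple t * w) =
      cs.simple t * ((cs.simple s * cs.simple t)⁻¹ ^ k * w) := by
  induction k with
  | zero => simp
  | succ k ih =>
    rw [pow_succ', mul_assoc, ih, pow_succ']
    simp [mul_assoc]

theorem GG_t (φ : B → W → ℤˣ) (hφ : ∀ s w, φ s (cs.simple s * w) = φ s w) (s t : B) (w : W) :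
    GG cs φ s t (cs.simple t * w) = GG cs φ s t w := by
  unfold GG
  have hr := cs.simple_mul_simple_pow s t
  have hr' : (cs.simple s * cs.simple t)⁻¹ ^ (M s t) = 1 := by rw [inv_pow, hr, inv_one]
  rw [Finset.prod_mul_distrib, Finset.prod_mul_distrib]
  congr 1
  · rw [← prod_inv' hr (fun z => φ s (cs.simple t * (z * w))),
      ← prod_shift hr' (fun z => φ s (cs.simple t * (z * w)))]
    refine Finset.prod_congr rfl fun k _ => ?_
    rw [t_r_t, simple_mul_simple_cancel_left, ← hφ, pow_succ']
    simp [mul_assoc]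
  · rw [← prod_inv' hr (fun z => φ t (z * w))]
    refine Finset.prod_congr rfl fun k _ => ?_
    rw [t_r_t, hφ]

theorem GG_s (φ : B → W → ℤˣ) (hφ : ∀ s w, φ s (cs.simple s * w) = φ s w) (s t : B) (w : W) :
    GG cs φ s t (cs.simple s * w) = GG cs φ s t w := by
  have := GG_r cs φ s t (cs.simple t * w)
  rw [mul_assoc, simple_mul_simple_cancel_left, GG_t cs φ hφ] at this
  exact this

theorem GG_WJ (φ : B → W → ℤˣ) (hφ : ∀ s w, φ s (cs.simple s * w) = φ s w) (s t : B) (w v : W)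
    (hv : v ∈ WJ cs {s, t}) : GG cs φ s t (v * w) = GG cs φ s t w := by
  induction hv using Subgroup.closure_induction generalizing w with
  | mem x hx =>
    rcases hx with ⟨j, (rfl | rfl), rfl⟩
    · exact GG_s cs φ hφ _ _ _
    · exact GG_t cs φ hφ _ _ _
  | one => rw [one_mul]
  | mul x y hx hy h1 h2 => rw [mul_assoc, h1, h2]
  | inv x hx h => rw [← h (x⁻¹ * w), mul_inv_cancel_left]

theorem pull (m k₀ : ℕ) (hk : k₀ < m) (α β : ℕ → ℤˣ) (h1 : ∀ k < m, k ≠ k₀ → β k = α k)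
    (h2 : β k₀ = 1) : ∏ k ∈ Finset.range m, α k = α k₀ * ∏ k ∈ Finset.range m, β k := by
  rw [← Finset.mul_prod_erase _ α (Finset.mem_range.2 hk),
    ← Finset.mul_prod_erase _ β (Finset.mem_range.2 hk), h2, one_mul]
  congr 1
  refine Finset.prod_congr rfl fun k hk => ?_
  rw [Finset.mem_erase, Finset.mem_range] at hk
  exact (h1 k hk.2 hk.1).symm

theorem GG_ph (hdim : ∀ T : Set B, 2 < T.ncard → (WJ cs T : Set W).Infinite)
    (b : B → B → ℤˣ) {s t : B} (hst : s < t) (h0 : M s t ≠ 0) (w : W) :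
    GG cs (ph cs b) s t w = b s t := by
  classical
  obtain ⟨v, hv, hd, hl⟩ := exists_top cs (WJ_pair_card cs hst.ne h0).1 w
  rw [← GG_WJ cs (ph cs b) (ph_mul cs b) s t w v hv]
  set x := v * w with hx
  clear_value x
  have hs := hd s (by simp)
  have ht := hd t (by simp)
  have hms := simple_mem_WJ cs (show s ∈ ({s, t} : Set B) by simp)
  have hmt := simple_mem_WJ cs (show t ∈ ({s, t} : Set B) by simp)
  have uniq : ∀ u, cs.IsLeftDescent x u → u = s ∨ u = t := by
    intro u hu
    by_contra hcon
    push Not at hcon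
    exact no_three cs hdim hs ht hu hst.ne hcon.1.symm hcon.2.symm
  have ht1 : Fn cs b x t = 1 := by
    rw [Fn, dif_neg]
    rintro ⟨u, hu, -, -, hu'⟩
    rcases uniq u hu' with rfl | rfl
    · exact hst.not_gt hu
    · exact lt_irrefl _ hu
  have hex : ∃ t, s < t ∧ M s t ≠ 0 ∧ cs.IsLeftDescent x s ∧ cs.IsLeftDescent x t :=
    ⟨t, hst, h0, hs, ht⟩
  have hch : hex.choose = t := by
    have := hex.choose_spec
    rcases uniq _ this.2.2.2 with h | h
    · exact absurd (h ▸ this.1) (lt_irrefl _)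
    · exact h
  set r := cs.simple s * cs.simple t with hr
  set m := M s t with hm
  have hrm : r ^ m = 1 := cs.simple_mul_simple_pow s t
  set α : ℕ → ℤˣ := fun k => if cs.length (tp cs s (cs.simple t * (r ^ k * x))) < cs.length x then
    Fn cs b (tp cs s (cs.simple t * (r ^ k * x))) s else 1 with hα
  set β : ℕ → ℤˣ := fun k => if cs.length (tp cs t (r ^ k * x)) < cs.length x then
    Fn cs b (tp cs t (r ^ k * x)) t else 1 with hβ
  have hs1 : Fn cs b x s = b s t * ∏ k ∈ Finset.range m, (α k * β k) := by
    rw [Fn, dif_pos hex]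
    simp only [hch, dite_eq_ite]
    rfl
  have hmp : 0 < m := Nat.pos_of_ne_zero h0
  have hrmem : ∀ k, r ^ k ∈ WJ cs {s, t} := fun k => pow_mem (mul_mem hms hmt) k
  have htr : ∀ k, cs.simple t * r ^ k ≠ 1 := by
    intro k h
    have := congrArg cs.lengthParity h
    rw [map_mul, map_pow, hr, map_mul, lengthParity_simple, lengthParity_simple,
      map_one cs.lengthParity,
      show (Multiplicative.ofAdd (1 : ZMod 2) * Multiplicative.ofAdd 1) = 1 by decide,
      one_pow, mul_one] at this
    exact absurd this (by decide)
  have key1 : ∀ k, k < m → k ≠ m - 1 →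
      cs.length (tp cs s (cs.simple t * (r ^ k * x))) < cs.length x := by
    intro k hk hk'
    unfold tp
    split_ifs
    · rw [← mul_assoc (cs.simple s), ← hr, ← mul_assoc, ← pow_succ']
      exact hl _ (hrmem _) (pow_ne_one cs hst.ne h0 (Nat.succ_pos k) (by omega))
    · rw [← mul_assoc]
      exact hl _ (mul_mem hmt (hrmem k)) (htr k)
  have key2 : ∀ k, k < m → k ≠ 0 → cs.length (tp cs t (r ^ k * x)) < cs.length x := by
    intro k hk hk'
    unfold tp
    split_ifs
    · rw [← mul_assoc]
      exact hl _ (mul_mem hmt (hrmem k)) (htr k)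
    · exact hl _ (hrmem k) (pow_ne_one cs hst.ne h0 (Nat.pos_of_ne_zero hk') hk)
  have e1 : tp cs t x = x := by
    unfold tp
    rw [if_neg]
    exact (show cs.length (cs.simple t * x) < cs.length x from ht).not_gt
  have e2' : tp cs s x = x := by
    unfold tp
    rw [if_neg]
    exact (show cs.length (cs.simple s * x) < cs.length x from hs).not_gt
  have e2 : tp cs s (cs.simple t * (r ^ (m - 1) * x)) = x := by
    rw [← tp_mul, ← mul_assoc (cs.simple s), ← hr, ← mul_assoc, ← pow_succ',
      Nat.sub_add_cancel hmp, hrm, one_mul, e2']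
  have hGG : GG cs (ph cs b) s t x = (∏ k ∈ Finset.range m,
      ph cs b s (cs.simple t * (r ^ k * x))) * ∏ k ∈ Finset.range m, ph cs b t (r ^ k * x) := by
    rw [← Finset.prod_mul_distrib]; rfl
  rw [hGG, pull m (m - 1) (by omega) (fun k => ph cs b s (cs.simple t * (r ^ k * x))) α, pull m 0 hmp (fun k => ph cs b t (r ^ k * x)) β]
  · simp only [ph, e2, pow_zero, one_mul, e1, ht1, hs1]
    rw [Finset.prod_mul_distrib, mul_assoc, mul_assoc (b s t), Int.units_mul_self, mul_one]
  · intro k hk hk'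
    simp only [hβ, key2 k hk hk', if_true]
    rfl
  · simp [hβ, e1]
  · intro k hk hk'
    simp only [hα, key1 k hk hk', if_true]
    rfl
  · simp [hα, e2]

end Cocycle

end Cox2

set_option linter.all false

namespace Cox2

open CoxeterSystem

section Gen

variable {F W : Type*} [Group F] [Group W] (π : F →* W)

/-- Invariant characters on the kernel. -/
def IsX (l : π.ker →* ℤˣ) : Prop :=
  ∀ (g : F) (r : π.ker), l ⟨g * r * g⁻¹, (inferInstance : π.ker.Normal).conj_mem _ r.2 g⟩ = l r

/-- The type of invariant characters on the kernel. -/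
def XX := {l : π.ker →* ℤˣ // IsX π l}

variable {π}

open Classical in
/-- Evaluation, extended by `1`. -/
noncomputable def ev (l : π.ker →* ℤˣ) (g : F) : ℤˣ := if h : π g = 1 then l ⟨g, h⟩ else 1

theorem ev_of {l : π.ker →* ℤˣ} {g : F} (h : π g = 1) : ev l g = l ⟨g, h⟩ := by
  unfold ev; rw [dif_pos h]

theorem ev_mul (l : π.ker →* ℤˣ) {g h : F} (hg : π g = 1) (hh : π h = 1) :
    ev l (g * h) = ev l g * ev l h := by
  rw [ev_of hg, ev_of hh, ev_of (show π (g * h) = 1 by rw [map_mul, hg, hh, one_mul])]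
  exact map_mul l ⟨g, hg⟩ ⟨h, hh⟩

theorem ev_one (l : π.ker →* ℤˣ) : ev l 1 = 1 := by
  rw [ev_of (map_one π)]
  exact map_one l

theorem ev_inv (l : π.ker →* ℤˣ) {g : F} (hg : π g = 1) : ev l g⁻¹ = ev l g := by
  have h1 : π g⁻¹ = 1 := by rw [map_inv, hg, inv_one]
  have := ev_mul l hg h1
  rw [mul_inv_cancel, ev_one] at this
  rw [← Int.units_inv_eq_self (ev l g)]
  exact eq_inv_of_mul_eq_one_right this.symm

theorem ev_conj {l : π.ker →* ℤˣ} (hl : IsX π l) (g : F) {r : F} (hr : π r = 1) :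
    ev l (g * r * g⁻¹) = ev l r := by
  rw [ev_of hr, ev_of (show π (g * r * g⁻¹) = 1 by simp [hr])]
  exact hl g ⟨r, hr⟩

theorem ev_mulc (l l' : π.ker →* ℤˣ) (g : F) : ev (l * l') g = ev l g * ev l' g := by
  unfold ev
  split_ifs
  · rfl
  · rw [one_mul]

theorem ev_div (l l' : π.ker →* ℤˣ) (g : F) : ev (l / l') g = ev l g / ev l' g := by
  unfold ev
  split_ifs
  · rfl
  · rw [div_one]

theorem isX_mul {l l' : π.ker →* ℤˣ} (h : IsX π l) (h' : IsX π l') : IsX π (l * l') := by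
  intro g r
  rw [MonoidHom.mul_apply, MonoidHom.mul_apply, h, h']

theorem isX_div {l l' : π.ker →* ℤˣ} (h : IsX π l) (h' : IsX π l') : IsX π (l / l') := by
  intro g r
  rw [MonoidHom.div_apply, MonoidHom.div_apply, h, h']

theorem ev_sq {l : π.ker →* ℤˣ} (hl : IsX π l) {g h : F} (hgh : π g = π h) (hg : π g ^ 2 = 1) :
    ev l (g ^ 2) = ev l (h ^ 2) := by
  have h1 : π (g⁻¹ * h) = 1 := by rw [map_mul, map_inv, hgh, inv_mul_cancel]
  have h2 : h ^ 2 = (g * (g⁻¹ * h) * g⁻¹) * (g ^ 2 * (g⁻¹ * h)) := by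
    simp [pow_two, mul_assoc]
  have h3 : π (g ^ 2) = 1 := by rw [map_pow, hg]
  rw [h2, ev_mul l (by simp [hgh]) (by rw [map_mul, h3, h1, one_mul]), ev_conj hl g h1,
    ev_mul l h3 h1, mul_comm, mul_assoc, Int.units_mul_self, mul_one]

theorem mkX {G : Type*} [Group G] (Θ : F →* G) (z : ℤˣ →* G) (hz : Function.Injective z)
    (hc : ∀ a g, z a * Θ g = Θ g * z a) (hR : ∀ r, π r = 1 → ∃ a, z a = Θ r) :
    ∃ l : π.ker →* ℤˣ, IsX π l ∧ ∀ r, π r = 1 → z (ev l r) = Θ r := by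
  have : ∀ r : π.ker, ∃ a, z a = Θ r := fun r => hR r r.2
  choose f hf using this
  refine ⟨⟨⟨f, ?_⟩, ?_⟩, ?_, ?_⟩
  · apply hz; rw [hf]; simp
  · intro a b
    apply hz
    simp [hf]
  · intro g r
    apply hz
    change z (f _) = z (f _)
    rw [hf, hf]
    simp only [map_mul, map_inv]
    rw [← hf r, ← hc, mul_inv_cancel_right]
  · intro r hr
    rw [ev_of hr]
    exact hf _

end Gen

section Count

variable {B : Type*} [Fintype B] [LinearOrder B] {M : CoxeterMatrix B}
  {W : Type*} [Group W] (cs : CoxeterSystem M W)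

/-- Words in the simple generators. -/
noncomputable def p0 : FreeGroup B →* W := FreeGroup.lift cs.simple

theorem p0_surj : Function.Surjective (p0 cs) := by
  rw [← MonoidHom.range_eq_top, eq_top_iff, ← cs.subgroup_closure_range_simple,
    Subgroup.closure_le]
  rintro _ ⟨s, rfl⟩
  exact ⟨FreeGroup.of s, by simp [p0]⟩

theorem ext_lemma {G : Type*} [Group G] (z : ℤˣ →* G) (hc : ∀ a g, z a * g = g * z a)
    (p : B → G) (hp : ∀ s t, (p s * p t) ^ (M s t) ∈ z.range) (r : FreeGroup B)
    (hr : p0 cs r = 1) : ∃ a, z a = FreeGroup.lift p r := by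
  have hn : z.range.Normal := ⟨by
    rintro _ ⟨a, rfl⟩ g
    rw [← hc, mul_inv_cancel_right]
    exact ⟨a, rfl⟩⟩
  let f : B → G ⧸ z.range := fun s => (p s : G ⧸ z.range)
  have hf : M.IsLiftable f := by
    intro s t
    have := hp s t
    rw [← QuotientGroup.eq_one_iff] at this
    exact this
  have key : (cs.lift ⟨f, hf⟩).comp (p0 cs) =
      (QuotientGroup.mk' z.range).comp (FreeGroup.lift p) := by
    ext s
    simp [p0, f]
  have := DFunLike.congr_fun key r
  simp only [MonoidHom.comp_apply, hr, map_one] at this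
  exact (QuotientGroup.eq_one_iff _).1 this.symm

variable {C ι : Type*} (e : B ⊕ C ≃ ι) (π : FreeGroup ι →* W)

/-- Lifted simple generator. -/
def xx (s : B) : FreeGroup ι := FreeGroup.of (e (Sum.inl s))

/-- Extra generator. -/
def yy (c : C) : FreeGroup ι := FreeGroup.of (e (Sum.inr c))

/-- Inclusion of words. -/
def jj : FreeGroup B →* FreeGroup ι := FreeGroup.lift (xx e)

/-- A word representing the extra generator. -/
noncomputable def wd (c : C) : FreeGroup B := (p0_surj cs (π (yy e c))).choose

theorem wd_spec (c : C) : p0 cs (wd cs e π c) = π (yy e c) :=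
  (p0_surj cs (π (yy e c))).choose_spec

/-- The relator expressing an extra generator. -/
noncomputable def rr (c : C) : FreeGroup ι := yy e c * (jj e (wd cs e π c))⁻¹

/-- Homomorphisms out of the free group. -/
def lf {G : Type*} [Group G] (p : B → G) (q : C → G) : FreeGroup ι →* G :=
  FreeGroup.lift (fun i => Sum.elim p q (e.symm i))

theorem lf_x {G : Type*} [Group G] (p : B → G) (q : C → G) (s : B) : lf e p q (xx e s) = p s := by
  simp [lf, xx]

theorem lf_y {G : Type*} [Group G] (p : B → G) (q : C → G) (c : C) : lf e p q (yy e c) = q c := by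
  simp [lf, yy]

theorem hom_eq {G : Type*} [Group G] {f g : FreeGroup ι →* G} (h1 : ∀ s, f (xx e s) = g (xx e s))
    (h2 : ∀ c, f (yy e c) = g (yy e c)) : f = g := by
  ext i
  obtain ⟨k, rfl⟩ := e.surjective i
  rcases k with s | c
  · exact h1 s
  · exact h2 c

theorem lf_j {G : Type*} [Group G] (p : B → G) (q : C → G) (u : FreeGroup B) :
    lf e p q (jj e u) = FreeGroup.lift p u := by
  have : (lf e p q).comp (jj e) = FreeGroup.lift p := by
    ext s; simp [jj, lf_x]
  exact DFunLike.congr_fun this u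

theorem pi_x
    (hπ : ∀ s, π (FreeGroup.of (e (Sum.inl s))) = cs.simple s) (s : B) : π (xx e s) = cs.simple s := hπ s

theorem pi_j
    (hπ : ∀ s, π (FreeGroup.of (e (Sum.inl s))) = cs.simple s) (u : FreeGroup B) : π (jj e u) = p0 cs u := by
  have : π.comp (jj e) = p0 cs := by
    ext s; simp [jj, p0, pi_x cs e π hπ]
  exact DFunLike.congr_fun this u

theorem pi_r
    (hπ : ∀ s, π (FreeGroup.of (e (Sum.inl s))) = cs.simple s) (c : C) : π (rr cs e π c) = 1 := by
  rw [rr, map_mul, map_inv, pi_j cs e π hπ, wd_spec, mul_inv_cancel]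

theorem pi_xx
    (hπ : ∀ s, π (FreeGroup.of (e (Sum.inl s))) = cs.simple s) (s : B) : π (xx e s ^ 2) = 1 := by
  rw [map_pow, pi_x cs e π hπ, simple_sq]

theorem pi_xy
    (hπ : ∀ s, π (FreeGroup.of (e (Sum.inl s))) = cs.simple s) (s t : B) : π ((xx e s * xx e t) ^ (M s t)) = 1 := by
  rw [map_pow, map_mul, pi_x cs e π hπ, pi_x cs e π hπ, simple_mul_simple_pow]

theorem ev_inj
    (hπ : ∀ s, π (FreeGroup.of (e (Sum.inl s))) = cs.simple s) {l : π.ker →* ℤˣ} (hl : IsX π l) (ha : ∀ s, ev l (xx e s ^ 2) = 1)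
    (hb : ∀ s t, s < t → M s t ≠ 0 → ev l ((xx e s * xx e t) ^ (M s t)) = 1)
    (hv : ∀ c, ev l (rr cs e π c) = 1) : l = 1 := by
  let K : Subgroup (FreeGroup ι) :=
    { carrier := {g | π g = 1 ∧ ev l g = 1}
      mul_mem' := fun {a b} ha hb => ⟨by rw [map_mul, ha.1, hb.1, one_mul],
        by rw [ev_mul l ha.1 hb.1, ha.2, hb.2, one_mul]⟩
      one_mem' := ⟨map_one π, ev_one l⟩
      inv_mem' := fun {a} ha => ⟨by rw [map_inv, ha.1, inv_one], by rw [ev_inv l ha.1, ha.2]⟩ }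
  have hK : ∀ g, g ∈ K ↔ (π g = 1 ∧ ev l g = 1) := fun g => Iff.rfl
  have hn : K.Normal := ⟨by
    rintro r ⟨h1, h2⟩ g
    exact ⟨by simp [h1], by rw [ev_conj hl g h1, h2]⟩⟩
  let f : B → FreeGroup ι ⧸ K := fun s => (xx e s : FreeGroup ι ⧸ K)
  have hlt : ∀ s t, s < t → (xx e s * xx e t) ^ (M s t) ∈ K := by
    intro s t hst
    by_cases h0 : M s t = 0
    · rw [h0, pow_zero]; exact one_mem _
    · exact ⟨pi_xy cs e π hπ s t, hb s t hst h0⟩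
  have hf : M.IsLiftable f := by
    intro s t
    have : (xx e s * xx e t) ^ (M s t) ∈ K := by
      rcases lt_trichotomy s t with h | rfl | h
      · exact hlt s t h
      · rw [M.diagonal, pow_one, ← pow_two]
        exact ⟨pi_xx cs e π hπ s, ha s⟩
      · have h1 := hn.conj_mem _ (hlt t s h) (xx e t)⁻¹
        rw [← conj_pow, M.symmetric t s] at h1
        convert h1 using 2
        group
    rw [← QuotientGroup.eq_one_iff] at this
    exact this
  have hj : ((cs.lift ⟨f, hf⟩).comp π).comp (jj e) = (QuotientGroup.mk' K).comp (jj e) := by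
    ext s
    simp [jj, pi_x cs e π hπ, f]
  have key : (cs.lift ⟨f, hf⟩).comp π = QuotientGroup.mk' K := by
    refine hom_eq e (fun s => ?_) (fun c => ?_)
    · simp [pi_x cs e π hπ, f]
    · have h1 := DFunLike.congr_fun hj (wd cs e π c)
      simp only [MonoidHom.comp_apply] at h1 ⊢
      rw [pi_j cs e π hπ, wd_spec] at h1
      rw [h1]
      symm
      have h2 : rr cs e π c ∈ K := ⟨pi_r cs e π hπ c, hv c⟩
      rw [← QuotientGroup.eq_one_iff] at h2
      have h3 : (QuotientGroup.mk' K) (rr cs e π c) = 1 := h2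
      rw [rr, map_mul, map_inv] at h3
      exact mul_inv_eq_one.1 h3
  ext r
  have h1 := DFunLike.congr_fun key r.1
  simp only [MonoidHom.comp_apply] at h1
  rw [show π r.1 = 1 from r.2, map_one] at h1
  have h2 : r.1 ∈ K := (QuotientGroup.eq_one_iff _).1 h1.symm
  have h3 := h2.2
  rw [ev_of h2.1] at h3
  rw [show l r = 1 from h3]
  rfl

theorem ex_chi
    (hπ : ∀ s, π (FreeGroup.of (e (Sum.inl s))) = cs.simple s) {l : π.ker →* ℤˣ} (hl : IsX π l) :
    ∃ χ : W →* ℤˣ, ∀ s, χ (cs.simple s) = ev l (xx e s ^ 2) := by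
  have hf : M.IsLiftable (fun s => ev l (xx e s ^ 2)) := by
    intro s t
    dsimp only
    rcases Nat.even_or_odd (M s t) with ⟨k, hk⟩ | ⟨k, hk⟩
    · rw [hk, pow_add, Int.units_mul_self]
    · have h1 : ev l (xx e t ^ 2) = ev l (xx e s ^ 2) := by
        have hrel := cs.simple_mul_simple_pow s t
        have hconj : π (xx e t) = π ((xx e s * xx e t) ^ k * xx e s *
            ((xx e s * xx e t) ^ k)⁻¹) := by
          simp only [map_mul, map_pow, map_inv, pi_x cs e π hπ]
          rw [eq_mul_inv_iff_mul_eq]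
          rw [hk, two_mul, add_assoc, pow_add, pow_succ'] at hrel
          have h2 : (cs.simple s * cs.simple t) ^ k * cs.simple s *
            (cs.simple t * (cs.simple s * cs.simple t) ^ k) = 1 := by
            rw [← hrel]; simp only [mul_assoc]
          rw [mul_eq_one_iff_eq_inv] at h2
          rw [h2, mul_inv_rev, inv_simple, ← inv_pow, mul_inv_rev, inv_simple, inv_simple]
          clear h2 hrel hk
          induction k with
          | zero => simp
          | succ k ih =>
            rw [pow_succ, ← mul_assoc, ih, pow_succ]
            simp only [mul_assoc]
        rw [ev_sq hl hconj (by rw [pi_x cs e π hπ, simple_sq]), conj_pow,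
          ev_conj hl _ (pi_xx cs e π hπ s)]
      rw [h1, Int.units_mul_self, one_pow]
  exact ⟨cs.lift ⟨_, hf⟩, fun s => cs.lift_apply_simple hf s⟩

theorem surj_chi
    (hπ : ∀ s, π (FreeGroup.of (e (Sum.inl s))) = cs.simple s) (χ : W →* ℤˣ) :
    ∃ l : π.ker →* ℤˣ, IsX π l ∧ ∀ s, ev l (xx e s ^ 2) = χ (cs.simple s) := by
  classical
  let z : ℤˣ →* ℂˣ := Units.map (Int.castRingHom ℂ)
  have hz : Function.Injective z := Units.map_injective Int.cast_injective
  let i : ℂˣ := Units.mk0 Complex.I Complex.I_ne_zero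
  let q : ℤˣ → ℂˣ := fun a => if a = 1 then 1 else i
  have hz1 : z (-1) = -1 := by ext; simp [z]
  have hi : i ^ 2 = -1 := by ext; simp [i]
  have hq : ∀ a, q a ^ 2 = z a := by
    intro a
    rcases Int.units_eq_one_or a with rfl | rfl
    · simp [q]
    · simp only [q, hz1]
      rw [if_neg (by decide), hi]
  let Θ : FreeGroup ι →* ℂˣ := FreeGroup.lift (fun k => q (χ (π (FreeGroup.of k))))
  have hΘ : ∀ g, Θ g ^ 2 = z (χ (π g)) := by
    intro g
    have : (powMonoidHom 2).comp Θ = z.comp (χ.comp π) := by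
      ext1 k
      simp [Θ, hq]
    exact DFunLike.congr_fun this g
  obtain ⟨l, hl, h⟩ := mkX (π := π) Θ z hz (fun a g => mul_comm _ _) (by
    intro r hr
    have := hΘ r
    rw [hr, map_one, map_one] at this
    have h2 : ((Θ r : ℂˣ) : ℂ) ^ 2 = 1 := by rw [← Units.val_pow_eq_pow_val, this]; rfl
    rw [pow_two] at h2
    rcases mul_self_eq_one_iff.1 h2 with h | h
    · exact ⟨1, by rw [map_one]; ext; simp [h]⟩
    · exact ⟨-1, by rw [hz1]; ext; simp [h]⟩)
  refine ⟨l, hl, fun s => hz ?_⟩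
  rw [h _ (pi_xx cs e π hπ s), map_pow, hΘ, pi_x cs e π hπ]

theorem surj_v
    (hπ : ∀ s, π (FreeGroup.of (e (Sum.inl s))) = cs.simple s) (v : C → ℤˣ) :
    ∃ l : π.ker →* ℤˣ, IsX π l ∧ (∀ s, ev l (xx e s ^ 2) = 1) ∧
      (∀ s t, ev l ((xx e s * xx e t) ^ (M s t)) = 1) ∧ ∀ c, ev l (rr cs e π c) = v c := by
  obtain ⟨l, hl, h⟩ := mkX (π := π) (lf e (fun _ => (1 : ℤˣ)) v) (MonoidHom.id ℤˣ)
    Function.injective_id (fun a g => mul_comm _ _) (fun r _ => ⟨_, rfl⟩)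
  have h : ∀ r, π r = 1 → ev l r = lf e (fun _ => (1 : ℤˣ)) v r := h
  refine ⟨l, hl, fun s => ?_, fun s t => ?_, fun c => ?_⟩
  · rw [h _ (pi_xx cs e π hπ s), map_pow, lf_x, one_pow]
  · rw [h _ (pi_xy cs e π hπ s t), map_pow, map_mul, lf_x, lf_x, one_mul, one_pow]
  · rw [h _ (pi_r cs e π hπ c), rr, map_mul, map_inv, lf_y, lf_j]
    have : (FreeGroup.lift fun (_ : B) => (1 : ℤˣ)) = 1 := by ext; simp
    rw [this]; simp

end Count

end Cox2

set_option linter.all false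

namespace Cox2

open CoxeterSystem

section Perm

variable {B : Type*} [Fintype B] [LinearOrder B] {M : CoxeterMatrix B}
  {W : Type*} [Group W] (cs : CoxeterSystem M W)

/-- The permutation attached to a simple generator. -/
def pm (φ : B → W → ℤˣ) (hφ : ∀ s w, φ s (cs.simple s * w) = φ s w) (s : B) :
    Equiv.Perm (W × ℤˣ) where
  toFun x := (cs.simple s * x.1, φ s x.1 * x.2)
  invFun x := (cs.simple s * x.1, φ s x.1 * x.2)
  left_inv x := by
    ext1
    · simp
    · simp only [hφ]; rw [← mul_assoc, Int.units_mul_self, one_mul]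
  right_inv x := by
    ext1
    · simp
    · simp only [hφ]; rw [← mul_assoc, Int.units_mul_self, one_mul]

/-- The central permutations. -/
def zz (W : Type*) : ℤˣ →* Equiv.Perm (W × ℤˣ) where
  toFun a :=
    { toFun := fun x => (x.1, a * x.2)
      invFun := fun x => (x.1, a * x.2)
      left_inv := fun x => by
        ext1
        · rfl
        · change a * (a * x.2) = x.2
          rw [← mul_assoc, Int.units_mul_self, one_mul]
      right_inv := fun x => by
        ext1
        · rfl
        · change a * (a * x.2) = x.2
          rw [← mul_assoc, Int.units_mul_self, one_mul] }
  map_one' := by ext x <;> simp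
  map_mul' a b := by
    ext x
    · rfl
    · simp [mul_assoc]

theorem zz_apply (a : ℤˣ) (x : W × ℤˣ) : zz W a x = (x.1, a * x.2) := rfl

variable (φ : B → W → ℤˣ) (hφ : ∀ s w, φ s (cs.simple s * w) = φ s w)

theorem pm_apply (s : B) (x : W × ℤˣ) :
    pm cs φ hφ s x = (cs.simple s * x.1, φ s x.1 * x.2) := rfl

theorem pm_pow (s t : B) (k : ℕ) (x : W × ℤˣ) :
    ((pm cs φ hφ s * pm cs φ hφ t) ^ k) x = ((cs.simple s * cs.simple t) ^ k * x.1,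
      (∏ j ∈ Finset.range k, (φ s (cs.simple t * ((cs.simple s * cs.simple t) ^ j * x.1)) *
        φ t ((cs.simple s * cs.simple t) ^ j * x.1))) * x.2) := by
  induction k with
  | zero => simp
  | succ k ih =>
    rw [pow_succ', Equiv.Perm.mul_apply, ih, Equiv.Perm.mul_apply, pm_apply, pm_apply,
      Finset.prod_range_succ]
    ext1
    · simp only [pow_succ', mul_assoc]
    · simp only
      rw [← mul_assoc, ← mul_assoc]
      congr 1
      rw [mul_comm]

/-- Centralizer of the central permutations. -/
abbrev GC (W : Type*) : Subgroup (Equiv.Perm (W × ℤˣ)) :=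
  Subgroup.centralizer (Set.range (zz W))

theorem pm_mem (s : B) : pm cs φ hφ s ∈ GC W := by
  rw [Subgroup.mem_centralizer_iff]
  rintro _ ⟨a, rfl⟩
  ext1 x
  rw [Equiv.Perm.mul_apply, Equiv.Perm.mul_apply, zz_apply, zz_apply, pm_apply, pm_apply]
  ext1
  · rfl
  · exact mul_left_comm _ _ _

theorem zz_mem (W : Type*) (a : ℤˣ) : zz W a ∈ GC W := by
  rw [Subgroup.mem_centralizer_iff]
  rintro _ ⟨b, rfl⟩
  rw [← map_mul, ← map_mul, mul_comm]

/-- The central embedding. -/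
def zc (W : Type*) : ℤˣ →* GC W := (zz W).codRestrict _ (zz_mem W)

theorem zc_inj (W : Type*) [Nonempty W] : Function.Injective (zc W) := by
  intro a b h
  have h1 : zz W a = zz W b := congrArg Subtype.val h
  obtain ⟨w⟩ := ‹Nonempty W›
  have h2 := congrArg Prod.snd (DFunLike.congr_fun h1 (w, 1))
  simpa [zz_apply] using h2

theorem zc_comm (W : Type*) (a : ℤˣ) (g : GC W) : zc W a * g = g * zc W a := by
  ext1
  exact (Subgroup.mem_centralizer_iff.1 g.2) _ ⟨a, rfl⟩

/-- The generator in the centralizer. -/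
def pc (s : B) : GC W := ⟨pm cs φ hφ s, pm_mem cs φ hφ s⟩

theorem pc_sq (s : B) : pc cs φ hφ s * pc cs φ hφ s = 1 := by
  ext1
  change pm cs φ hφ s * pm cs φ hφ s = 1
  ext1 x
  rw [Equiv.Perm.mul_apply]
  exact (pm cs φ hφ s).left_inv x

theorem pc_pow (s t : B) (c : ℤˣ) (h : ∀ w, GG cs φ s t w = c) :
    (pc cs φ hφ s * pc cs φ hφ t) ^ (M s t) = zc W c := by
  ext1
  change (pm cs φ hφ s * pm cs φ hφ t) ^ (M s t) = zz W c
  ext1 x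
  rw [pm_pow, zz_apply, simple_mul_simple_pow, one_mul, ← h x.1]
  rfl

variable {C ι : Type*} (e : B ⊕ C ≃ ι) (π : FreeGroup ι →* W)

theorem surj_b
    (hπ : ∀ s, π (FreeGroup.of (e (Sum.inl s))) = cs.simple s) (hdim : ∀ T : Set B, 2 < T.ncard → (WJ cs T : Set W).Infinite)
    (b : B → B → ℤˣ) :
    ∃ l : π.ker →* ℤˣ, IsX π l ∧ (∀ s, ev l (xx e s ^ 2) = 1) ∧
      (∀ s t, s < t → M s t ≠ 0 → ev l ((xx e s * xx e t) ^ (M s t)) = b s t) ∧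
      ∀ c, ev l (rr cs e π c) = 1 := by
  classical
  set p : B → GC W := pc cs (ph cs b) (ph_mul cs b) with hp
  have hpow : ∀ s t, s < t → M s t ≠ 0 → (p s * p t) ^ (M s t) = zc W (b s t) :=
    fun s t hst h0 => pc_pow cs _ _ s t _ (GG_ph cs hdim b hst h0)
  have hlt : ∀ s t, s < t → (p s * p t) ^ (M s t) ∈ (zc W).range := by
    intro s t hst
    by_cases h0 : M s t = 0
    · rw [h0, pow_zero]; exact one_mem _
    · exact ⟨_, (hpow s t hst h0).symm⟩
  have hall : ∀ s t, (p s * p t) ^ (M s t) ∈ (zc W).range := by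
    intro s t
    rcases lt_trichotomy s t with h | rfl | h
    · exact hlt s t h
    · rw [M.diagonal, pow_one, hp, pc_sq]; exact one_mem _
    · obtain ⟨a, ha⟩ := hlt t s h
      refine ⟨a, ?_⟩
      have h1 : p s * p t = (p t)⁻¹ * (p t * p s) * (p t)⁻¹⁻¹ := by group
      rw [h1, conj_pow, M.symmetric s t, ← ha, ← zc_comm, mul_inv_cancel_right]
  set q : C → GC W := fun c => FreeGroup.lift p (wd cs e π c) with hq
  set κ : FreeGroup ι →* FreeGroup B := lf e FreeGroup.of (wd cs e π) with hκ
  have hΘ : lf e p q = (FreeGroup.lift p).comp κ := by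
    refine hom_eq e (fun s => ?_) (fun c => ?_)
    · simp [hκ, lf_x]
    · simp [hκ, lf_y, hq]
  have hπκ : π = (p0 cs).comp κ := by
    refine hom_eq e (fun s => ?_) (fun c => ?_)
    · simp [hκ, lf_x, pi_x cs e π hπ, p0]
    · simp [hκ, lf_y, wd_spec]
  obtain ⟨l, hl, h⟩ := mkX (π := π) (lf e p q) (zc W) (zc_inj W)
    (fun a g => zc_comm W a _) (by
      intro r hr
      rw [hΘ]
      rw [hπκ] at hr
      exact ext_lemma cs (zc W) (zc_comm W) p hall (κ r) hr)
  refine ⟨l, hl, fun s => zc_inj W ?_, fun s t hst h0 => zc_inj W ?_, fun c => zc_inj W ?_⟩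
  · rw [h _ (pi_xx cs e π hπ s), map_pow, lf_x, pow_two, hp, pc_sq, map_one]
  · rw [h _ (pi_xy cs e π hπ s t), map_pow, map_mul, lf_x, lf_x, hpow s t hst h0]
  · rw [h _ (pi_r cs e π hπ c), rr, map_mul, map_inv, lf_y, lf_j, hq, mul_inv_cancel, map_one]

theorem count
    (hπ : ∀ s, π (FreeGroup.of (e (Sum.inl s))) = cs.simple s) (hdim : ∀ T : Set B, 2 < T.ncard → (WJ cs T : Set W).Infinite) :
    Nonempty (XX π ≃ (W →* ℤˣ) × (Ed M → ℤˣ) × (C → ℤˣ)) := by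
  classical
  choose χ hχ using fun l : XX π => ex_chi cs e π hπ l.2
  let Ψ : XX π → (W →* ℤˣ) × (Ed M → ℤˣ) × (C → ℤˣ) := fun l =>
    (χ l, fun p => ev l.1 ((xx e p.1.1 * xx e p.1.2) ^ (M p.1.1 p.1.2)),
      fun c => ev l.1 (rr cs e π c))
  refine ⟨Equiv.ofBijective Ψ ⟨?_, ?_⟩⟩
  · intro l l' h
    have h1 : χ l = χ l' := congrArg Prod.fst h
    have h2 := congrArg (fun x => x.2.1) h
    have h3 := congrArg (fun x => x.2.2) h
    have := ev_inj cs e π hπ (isX_div l.2 l'.2) (by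
      intro s
      rw [ev_div, ← hχ l, ← hχ l', h1, div_self']) (by
      intro s t hst h0
      have := congrFun h2 ⟨(s, t), hst, h0⟩
      simp only [Ψ] at this
      rw [ev_div, this, div_self']) (by
      intro c
      have := congrFun h3 c
      simp only [Ψ] at this
      rw [ev_div, this, div_self'])
    exact Subtype.ext (div_eq_one.1 this)
  · rintro ⟨χ₀, b, v⟩
    obtain ⟨l1, hl1, h1⟩ := surj_chi cs e π hπ χ₀
    let b' : B → B → ℤˣ := fun s t => (if h : s < t ∧ M s t ≠ 0 then b ⟨(s, t), h⟩ else 1) /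
      ev l1 ((xx e s * xx e t) ^ (M s t))
    obtain ⟨l2, hl2, ha2, hb2, hv2⟩ := surj_b cs e π hπ hdim b'
    obtain ⟨l3, hl3, ha3, hb3, hv3⟩ := surj_v cs e π hπ
      (fun c => v c / ev l1 (rr cs e π c))
    let l : XX π := ⟨l1 * l2 * l3, isX_mul (isX_mul hl1 hl2) hl3⟩
    refine ⟨l, ?_⟩
    refine Prod.ext ?_ (Prod.ext ?_ ?_)
    · change χ l = χ₀
      apply cs.ext_simple
      intro s
      rw [hχ l, ev_mulc, ev_mulc, h1, ha2, ha3, mul_one, mul_one]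
    · funext p
      change ev (l1 * l2 * l3) _ = b p
      rw [ev_mulc, ev_mulc, hb2 _ _ p.2.1 p.2.2, hb3]
      simp only [b']
      rw [dif_pos p.2, mul_one, mul_div_cancel]
    · funext c
      change ev (l1 * l2 * l3) _ = v c
      rw [ev_mulc, ev_mulc, hv2, hv3, mul_one, mul_div_cancel]

end Perm

theorem rank_main {B B' W : Type*} [Fintype B] [LinearOrder B] [Fintype B'] [LinearOrder B']
    [Group W] {M : CoxeterMatrix B} {M' : CoxeterMatrix B'}
    (cs : CoxeterSystem M W) (cs' : CoxeterSystem M' W)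
    (hdim : ∀ T : Set B, 2 < T.ncard → (WJ cs T : Set W).Infinite)
    (hdim' : ∀ T : Set B', 2 < T.ncard → (WJ cs' T : Set W).Infinite)
    (hE : Nat.card (Ed M) = Nat.card (Ed M')) : Nat.card B = Nat.card B' := by
  let π : FreeGroup (B ⊕ B') →* W := FreeGroup.lift (Sum.elim cs.simple cs'.simple)
  obtain ⟨e1⟩ := count cs (Equiv.refl (B ⊕ B')) π (fun s => by simp [π]) hdim
  obtain ⟨e2⟩ := count cs' (Equiv.sumComm B' B) π (fun s => by simp [π]) hdim'
  have hcard := Nat.card_congr (e1.symm.trans e2)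
  simp only [Nat.card_prod, Nat.card_fun, hE] at hcard
  have hfin : Finite (W →* ℤˣ) := by
    refine Finite.of_injective (fun χ : W →* ℤˣ => fun s => χ (cs.simple s)) ?_
    intro χ χ' h
    exact cs.ext_simple (fun s => congrFun h s)
  have h0 : 0 < Nat.card (W →* ℤˣ) := Nat.card_pos
  have h1 := Nat.eq_of_mul_eq_mul_left h0 hcard
  have h2 : Nat.card ℤˣ = 2 := by rw [Nat.card_eq_fintype_card]; rfl
  rw [h2] at h1
  have h3 := Nat.eq_of_mul_eq_mul_left (by positivity) h1
  exact (Nat.pow_right_injective le_rfl h3).symm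

end Cox2

theorem stmt_19 {B B' : Type*} {W : Type*} [Group W] [Finite B] [Finite B']
    {M : CoxeterMatrix B} {M' : CoxeterMatrix B'}
    (cs : CoxeterSystem M W) (cs' : CoxeterSystem M' W)
    (hdim : ∀ T : Set B, 2 < T.ncard → (Subgroup.closure (cs.simple '' T) : Set W).Infinite)
    (hdim' : ∀ T' : Set B', 2 < T'.ncard →
      (Subgroup.closure (cs'.simple '' T') : Set W).Infinite) :
    Nat.card B = Nat.card B' ∧
    ∃ e : {p : B × B // p.1 ≠ p.2 ∧ M p.1 p.2 ≠ 0} ≃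
          {q : B' × B' // q.1 ≠ q.2 ∧ M' q.1 q.2 ≠ 0},
      ∀ p, M p.1.1 p.1.2 = M' (e p).1.1 (e p).1.2 := by
  have : Fintype B := Fintype.ofFinite B
  have : Fintype B' := Fintype.ofFinite B'
  letI : LinearOrder B := LinearOrder.lift' (Finite.equivFin B) (Finite.equivFin B).injective
  letI : LinearOrder B' := LinearOrder.lift' (Finite.equivFin B') (Finite.equivFin B').injective
  obtain ⟨h1, h2⟩ := Cox2.edges_main cs cs' hdim hdim'
  exact ⟨Cox2.rank_main cs cs' hdim hdim' h1, h2⟩
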